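/- There exists a constant C > 0 depending only on B and σ² such that for every n ≥ 1, every v > 0, and every probability measure P_X on [−1,1]^{d_in}, the minimax risk satisfies R_n(G_{L,v}) ≤ C·L·v·( ((L−2)·log d̄ + log(8e·d_in)) / n )^{1/2}; moreover, provided v·√n ≥ e, the dimension-free bound R_n(G_{L,v}) ≤ C·L·v·( ((L−2)·log(v·√n) + log(8e·d_in)) / n )^{1/2} also holds. -/

import Mathlib

open MeasureTheory

noncomputable section

/-- Entrywise `ℓ¹` norm of the top-left `m × n` block of an array of reals. -/
def ell1 (m n : ℕ) (A : ℕ → ℕ → ℝ) : ℝ :=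
  ∑ i ∈ Finset.range m, ∑ j ∈ Finset.range n, |A i j|

/-- Product of the layer matrices `W a, W (a+1), …, W (a+n-1)`, viewed as a map from
layer `a` to layer `a + n`.  Here `W ℓ` denotes the `d ℓ × d (ℓ+1)` matrix between
layer `ℓ` and layer `ℓ + 1` (in the paper's notation, `W ℓ = W_{ℓ+1}`). -/
def layerProd (d : ℕ → ℕ) (W : ℕ → ℕ → ℕ → ℝ) (a : ℕ) : ℕ → ℕ → ℕ → ℝ
  | 0 => fun i j => if i = j then (1 : ℝ) else 0
  | n + 1 => fun i k =>
      ∑ j ∈ Finset.range (d (a + n)), layerProd d W a n i j * W (a + n) j k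

/-- A depth-`L` nonnegative-weight ramp network.  Layers are indexed by `ℓ = 0` (output)
through `ℓ = L` (the doubled input layer), with `d 0 = 1`.  The scalar `w0` is the output
weight and `W ℓ` is the paper's matrix `W_{ℓ+1} ∈ ℝ^{d_ℓ × d_{ℓ+1}}` (only the entries
with indices `< d ℓ`, `< d (ℓ+1)` are relevant). -/
structure RampNet (L d_in : ℕ) (d : ℕ → ℕ) where
  w0 : ℝ
  W : ℕ → ℕ → ℕ → ℝ
  w0_nonneg : 0 ≤ w0
  W_nonneg : ∀ ℓ i j, 0 ≤ W ℓ i j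

namespace RampNet

variable {L d_in : ℕ} {d : ℕ → ℕ}

/-- `zRev L d_in d W x k` is the vector `z^{(L-k)}` of unit outputs at layer `L - k`:
`z^{(L)}` is the doubled input and `z^{(ℓ)}_j = ±max((W_{ℓ+1} z^{(ℓ+1)})_j, 0)`, the sign
depending on whether `j` is in the first half of the layer. -/
def zRev (L d_in : ℕ) (d : ℕ → ℕ) (W : ℕ → ℕ → ℕ → ℝ) (x : ℕ → ℝ) : ℕ → ℕ → ℝ
  | 0 => fun j => if j < d_in then x j else -x (j - d_in)
  | k + 1 => fun j =>
      if j < d (L - (k + 1)) / 2 then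
        max (∑ i ∈ Finset.range (d (L - k)), W (L - (k + 1)) j i * zRev L d_in d W x k i) 0
      else
        -max (∑ i ∈ Finset.range (d (L - k)), W (L - (k + 1)) j i * zRev L d_in d W x k i) 0

/-- The network function `f(W,x) = w0 · (W_1 z^{(1)})`. -/
def eval (net : RampNet L d_in d) (x : ℕ → ℝ) : ℝ :=
  net.w0 * ∑ j ∈ Finset.range (d 1), net.W 0 0 j * zRev L d_in d net.W x (L - 1) j

/-- The subnetwork variation `V_ℓ^{out}(W) = w0 · ‖W_1 ⋯ W_ℓ‖₁` (equal to `w0` at `ℓ = 0`). -/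
def Vout (net : RampNet L d_in d) (ℓ : ℕ) : ℝ :=
  net.w0 * ell1 (d 0) (d ℓ) (layerProd d net.W 0 ℓ)

/-- The subnetwork variation `V_ℓ^{in}(W) = ‖W_{ℓ+1} ⋯ W_L‖₁`. -/
def Vin (net : RampNet L d_in d) (ℓ : ℕ) : ℝ :=
  ell1 (d ℓ) (d L) (layerProd d net.W ℓ (L - ℓ))

/-- The variation `V(W) = w0 · ‖W_1 W_2 ⋯ W_L‖₁`. -/
def Vtot (net : RampNet L d_in d) : ℝ :=
  net.w0 * ell1 (d 0) (d L) (layerProd d net.W 0 L)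

/-- The average variation `V̄(W) = (1/L) Σ_{ℓ=0}^{L-1} (V_ℓ^{out} + V_ℓ^{in})/2`. -/
def Vbar (net : RampNet L d_in d) : ℝ :=
  (1 / (L : ℝ)) * ∑ ℓ ∈ Finset.range L, (net.Vout ℓ + net.Vin ℓ) / 2

/-- The composite variation `v(W) = V̄(W) · √(V(W))`. -/
def compVar (net : RampNet L d_in d) : ℝ :=
  net.Vbar * Real.sqrt net.Vtot

end RampNet

/-- The class `F_{L,v}` of depth-`L` ramp-network functions with composite variation at
most `v` (as functions of the input coordinates `x : ℕ → ℝ`, only the first `d_in` of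
which matter). -/
def FLv (L d_in : ℕ) (d : ℕ → ℕ) (v : ℝ) : Set ((ℕ → ℝ) → ℝ) :=
  {g | ∃ net : RampNet L d_in d, net.compVar ≤ v ∧ ∀ x, g x = net.eval x}

/-- The geometric mean `d̄` of `d 2, …, d (L-1)` (equal to `1` when `L = 2`). -/
def dbar (L : ℕ) (d : ℕ → ℕ) : ℝ :=
  (∏ ℓ ∈ Finset.Icc 2 (L - 1), (d ℓ : ℝ)) ^ (((L : ℝ) - 2)⁻¹)

open ProbabilityTheory

/-- The joint law of `(X, f(X) + ε)` where `X ∼ P_X` and `ε ∼ N(0,σ²)` is independent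
of `X`. -/
def regLaw (P_X : Measure (ℕ → ℝ)) (f : (ℕ → ℝ) → ℝ) (σ2 : NNReal) :
    Measure ((ℕ → ℝ) × ℝ) :=
  Measure.map (fun p : (ℕ → ℝ) × ℝ => (p.1, f p.1 + p.2))
    (P_X.prod (gaussianReal 0 σ2))

/-! ### Least squares over a finite set of candidate functions -/

section LeastSquares

/-- Exponential moment of the excess squared error under Gaussian noise. -/
lemma integral_exp_excess_gaussian {σ2 : NNReal} (hσ2 : 0 < σ2) (δ : ℝ) :
    ∫ e, Real.exp (-(1 / (4 * (σ2 : ℝ)) * ((δ + e) ^ 2 - e ^ 2))) ∂(gaussianReal 0 σ2) =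
      Real.exp (-(δ ^ 2 / (8 * σ2))) := by
  have hs : (0 : ℝ) < σ2 := by exact_mod_cast hσ2
  have h := congrFun (mgf_id_gaussianReal (μ := 0) (v := σ2)) (-(δ / (2 * (σ2 : ℝ))))
  simp only [mgf, id] at h
  have h2 : ∀ e : ℝ, Real.exp (-(1 / (4 * (σ2 : ℝ)) * ((δ + e) ^ 2 - e ^ 2))) =
      Real.exp (-(δ ^ 2 / (4 * σ2))) * Real.exp (-(δ / (2 * (σ2 : ℝ))) * e) := by
    intro e
    rw [← Real.exp_add]
    congr 1
    field_simp
    ring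
  simp_rw [h2]
  rw [integral_const_mul, h, ← Real.exp_add]
  congr 1
  field_simp
  ring

/-- The excess squared error `(y - g x)² - (y - f x)²` at a data point `(x, y)`. -/
def excess (f g : (ℕ → ℝ) → ℝ) (p : (ℕ → ℝ) × ℝ) : ℝ :=
  (p.2 - g p.1) ^ 2 - (p.2 - f p.1) ^ 2

variable {P_X : Measure (ℕ → ℝ)} [IsProbabilityMeasure P_X] {f g : (ℕ → ℝ) → ℝ} {B : ℝ}
  {σ2 : NNReal}

lemma measurable_excess (hf : Measurable f) (hg : Measurable g) : Measurable (excess f g) := by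
  unfold excess
  fun_prop

lemma measurable_regMap (hf : Measurable f) :
    Measurable (fun p : (ℕ → ℝ) × ℝ => (p.1, f p.1 + p.2)) := by
  fun_prop

lemma isProbabilityMeasure_regLaw (hf : Measurable f) :
    IsProbabilityMeasure (regLaw P_X f σ2) :=
  Measure.isProbabilityMeasure_map (measurable_regMap hf).aemeasurable

lemma excess_regMap (p : (ℕ → ℝ) × ℝ) :
    excess f g (p.1, f p.1 + p.2) = (f p.1 - g p.1 + p.2) ^ 2 - p.2 ^ 2 := by
  simp only [excess]
  ring

lemma integrable_sq_sub (hf : Measurable f) (hg : Measurable g) (hfB : ∀ x, |f x| ≤ B)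
    (hgB : ∀ x, |g x| ≤ B) : Integrable (fun x => (f x - g x) ^ 2) P_X := by
  refine Integrable.of_bound (C := (2 * B) ^ 2) (by fun_prop) (ae_of_all _ fun x => ?_)
  rw [Real.norm_eq_abs, abs_pow]
  have := abs_sub (f x) (g x)
  gcongr
  linarith [hfB x, hgB x]

lemma integrable_excess (hf : Measurable f) (hg : Measurable g)
    (hfB : ∀ x, |f x| ≤ B) (hgB : ∀ x, |g x| ≤ B) :
    Integrable (excess f g) (regLaw P_X f σ2) ∧
      ∫ p, excess f g p ∂(regLaw P_X f σ2) = ∫ x, (f x - g x) ^ 2 ∂P_X := by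
  have hid : Integrable (fun e : ℝ => e) (gaussianReal 0 σ2) :=
    (memLp_id_gaussianReal 1).integrable (by simp)
  have h1 : Integrable (fun p : (ℕ → ℝ) × ℝ => (f p.1 - g p.1) ^ 2)
      (P_X.prod (gaussianReal 0 σ2)) := (integrable_sq_sub hf hg hfB hgB).comp_fst _
  have h2' : Integrable (fun x => 2 * (f x - g x)) P_X := by
    refine Integrable.of_bound (C := 2 * (2 * B)) (by fun_prop) (ae_of_all _ fun x => ?_)
    rw [Real.norm_eq_abs, abs_mul, abs_two]
    have := abs_sub (f x) (g x)
    gcongr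
    linarith [hfB x, hgB x]
  have h2 : Integrable (fun p : (ℕ → ℝ) × ℝ => (2 * (f p.1 - g p.1)) * p.2)
      (P_X.prod (gaussianReal 0 σ2)) := h2'.mul_prod hid
  have heq : (fun p : (ℕ → ℝ) × ℝ => excess f g (p.1, f p.1 + p.2)) =
      fun p => (f p.1 - g p.1) ^ 2 + (2 * (f p.1 - g p.1)) * p.2 := by
    funext p
    rw [excess_regMap]
    ring
  have hm := (measurable_excess hf hg).aestronglyMeasurable (μ := regLaw P_X f σ2)
  constructor
  · rw [regLaw, integrable_map_measure hm (measurable_regMap hf).aemeasurable]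
    change Integrable (fun p : (ℕ → ℝ) × ℝ => excess f g (p.1, f p.1 + p.2)) _
    rw [heq]
    exact h1.add h2
  · rw [regLaw, integral_map (measurable_regMap hf).aemeasurable hm, heq, integral_add h1 h2,
      integral_prod_mul (fun x => 2 * (f x - g x)) (fun e : ℝ => e), integral_id_gaussianReal,
      mul_zero, add_zero, integral_fun_fst (fun x => (f x - g x) ^ 2)]
    simp

/-- The rate constant in the exponential moment bound for the excess squared error. -/
def expRate (B : ℝ) (σ2 : NNReal) : ℝ := (8 * (σ2 : ℝ) * (1 + B ^ 2 / (2 * σ2)))⁻¹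

lemma expRate_pos (hσ2 : 0 < σ2) : 0 < expRate B σ2 := by
  have hs : (0 : ℝ) < σ2 := by exact_mod_cast hσ2
  unfold expRate
  positivity

lemma exp_neg_sq_le (hσ2 : 0 < σ2) {δ : ℝ} (hδ : |δ| ≤ 2 * B) :
    Real.exp (-(δ ^ 2 / (8 * (σ2 : ℝ)))) ≤ 1 - expRate B σ2 * δ ^ 2 := by
  have hs : (0 : ℝ) < σ2 := by exact_mod_cast hσ2
  have h4 : δ ^ 2 ≤ 4 * B ^ 2 := by
    have : |δ| ^ 2 ≤ (2 * B) ^ 2 := by gcongr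
    rw [sq_abs] at this
    linarith
  set u := δ ^ 2 / (8 * (σ2 : ℝ)) with hu
  have hu0 : 0 ≤ u := by positivity
  have huU : u ≤ B ^ 2 / (2 * σ2) := by
    rw [hu, div_le_div_iff₀ (by positivity) (by positivity)]
    nlinarith
  have h1 : Real.exp (-u) ≤ (1 + u)⁻¹ := by
    rw [Real.exp_neg]
    gcongr
    linarith [Real.add_one_le_exp u]
  have h2 : (1 + u)⁻¹ = 1 - u / (1 + u) := by field_simp; ring
  have h3 : expRate B σ2 * δ ^ 2 = u / (1 + B ^ 2 / (2 * σ2)) := by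
    rw [hu, expRate]
    field_simp
  rw [h3]
  have h5 : u / (1 + B ^ 2 / (2 * σ2)) ≤ u / (1 + u) := by gcongr
  linarith

lemma integral_exp_excess (hσ2 : 0 < σ2) (hf : Measurable f) (hg : Measurable g)
    (hfB : ∀ x, |f x| ≤ B) (hgB : ∀ x, |g x| ≤ B) :
    Integrable (fun p => Real.exp (-(1 / (4 * (σ2 : ℝ)) * excess f g p))) (regLaw P_X f σ2) ∧
      ∫ p, Real.exp (-(1 / (4 * (σ2 : ℝ)) * excess f g p)) ∂(regLaw P_X f σ2) ≤
        Real.exp (-(expRate B σ2 * ∫ x, (f x - g x) ^ 2 ∂P_X)) := by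
  have hs : (0 : ℝ) < σ2 := by exact_mod_cast hσ2
  have hd : ∀ x, |f x - g x| ≤ 2 * B := fun x => by
    linarith [abs_sub (f x) (g x), hfB x, hgB x]
  have hme := measurable_excess hf hg
  have hm : AEStronglyMeasurable (fun p => Real.exp (-(1 / (4 * (σ2 : ℝ)) * excess f g p)))
      (regLaw P_X f σ2) := by
    apply Measurable.aestronglyMeasurable
    fun_prop
  have hintegr : Integrable (fun p : (ℕ → ℝ) × ℝ =>
      Real.exp (-(1 / (4 * (σ2 : ℝ)) * ((f p.1 - g p.1 + p.2) ^ 2 - p.2 ^ 2))))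
      (P_X.prod (gaussianReal 0 σ2)) := by
    have hdom : Integrable (fun e : ℝ => Real.exp (B / σ2 * e) + Real.exp (-(B / σ2) * e))
        (gaussianReal 0 σ2) :=
      (integrable_exp_mul_gaussianReal _).add (integrable_exp_mul_gaussianReal _)
    refine (hdom.comp_snd P_X).mono' (by apply Measurable.aestronglyMeasurable; fun_prop)
      (ae_of_all _ fun p => ?_)
    rw [Real.norm_eq_abs, Real.abs_exp]
    have hle : -(1 / (4 * (σ2 : ℝ)) * ((f p.1 - g p.1 + p.2) ^ 2 - p.2 ^ 2)) ≤
        B / σ2 * |p.2| := by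
      have h1 : -((f p.1 - g p.1) * p.2) ≤ 2 * B * |p.2| := by
        calc -((f p.1 - g p.1) * p.2) ≤ |(f p.1 - g p.1) * p.2| := neg_le_abs _
          _ = |f p.1 - g p.1| * |p.2| := abs_mul _ _
          _ ≤ _ := by gcongr; exact hd _
      have h2 : -(1 / (4 * (σ2 : ℝ)) * ((f p.1 - g p.1 + p.2) ^ 2 - p.2 ^ 2)) =
        (-(f p.1 - g p.1) ^ 2 + 2 * (-((f p.1 - g p.1) * p.2))) / (4 * σ2) := by
        field_simp
        ring
      rw [h2, div_mul_eq_mul_div, div_le_div_iff₀ (by positivity) hs]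
      have : (-(f p.1 - g p.1) ^ 2 + 2 * (-((f p.1 - g p.1) * p.2))) ≤ B * |p.2| * 4 := by
        nlinarith [sq_nonneg (f p.1 - g p.1)]
      nlinarith
    refine (Real.exp_le_exp.2 hle).trans ?_
    rcases abs_cases p.2 with ⟨h, -⟩ | ⟨h, -⟩ <;> rw [h]
    · exact le_add_of_nonneg_right (Real.exp_pos _).le
    · rw [mul_neg, ← neg_mul]
      exact le_add_of_nonneg_left (Real.exp_pos _).le
  constructor
  · rw [regLaw, integrable_map_measure hm (measurable_regMap hf).aemeasurable]
    refine hintegr.congr (ae_of_all _ fun p => ?_)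
    simp only [Function.comp, excess_regMap]
  · rw [regLaw, integral_map (measurable_regMap hf).aemeasurable hm]
    simp only [excess_regMap]
    rw [integral_prod _ hintegr]
    simp only [integral_exp_excess_gaussian hσ2]
    have hsq := integrable_sq_sub (P_X := P_X) hf hg hfB hgB
    calc ∫ x, Real.exp (-((f x - g x) ^ 2 / (8 * (σ2 : ℝ)))) ∂P_X
        ≤ ∫ x, (1 - expRate B σ2 * (f x - g x) ^ 2) ∂P_X :=
          integral_mono_of_nonneg (ae_of_all _ fun x => (Real.exp_pos _).le)
            ((integrable_const _).sub (hsq.const_mul _))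
            (ae_of_all _ fun x => exp_neg_sq_le hσ2 (hd x))
      _ = 1 - expRate B σ2 * ∫ x, (f x - g x) ^ 2 ∂P_X := by
          rw [integral_sub (integrable_const _) (hsq.const_mul _), integral_const_mul]
          simp
      _ ≤ _ := by
          linarith [Real.add_one_le_exp (-(expRate B σ2 * ∫ x, (f x - g x) ^ 2 ∂P_X))]

lemma exists_measurable_argmin {α : Type*} [MeasurableSpace α] {N : ℕ} (hN : 0 < N)
    (R : Fin N → α → ℝ) (hR : ∀ i, Measurable (R i)) :
    ∃ idx : α → Fin N, Measurable idx ∧ ∀ a j, R (idx a) a ≤ R j a := by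
  classical
  have hex : ∀ a, ∃ k : ℕ, ∃ h : k < N, ∀ j, R ⟨k, h⟩ a ≤ R j a := fun a => by
    have : Nonempty (Fin N) := ⟨⟨0, hN⟩⟩
    obtain ⟨i, hi⟩ := Finite.exists_min (fun i => R i a)
    exact ⟨i, i.2, hi⟩
  have hmeas : ∀ k : ℕ, MeasurableSet {a | ∃ h : k < N, ∀ j, R ⟨k, h⟩ a ≤ R j a} := by
    intro k
    by_cases h : k < N
    · simp only [h, exists_true_left, Set.ofPred_forall]
      exact MeasurableSet.iInter fun j => measurableSet_le (hR _) (hR _)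
    · simp [h]
  have hm := measurable_find hex hmeas
  refine ⟨fun a => ⟨Nat.find (hex a), (Nat.find_spec (hex a)).choose⟩, ?_,
    fun a => (Nat.find_spec (hex a)).choose_spec⟩
  refine measurable_to_countable' fun i => ?_
  have : (fun a => (⟨Nat.find (hex a), (Nat.find_spec (hex a)).choose⟩ : Fin N)) ⁻¹' {i} =
      (fun a => Nat.find (hex a)) ⁻¹' {(i : ℕ)} := by
    ext a
    simp [Fin.ext_iff]
  rw [this]
  exact hm (MeasurableSet.singleton _)

/-- Oracle inequality for least squares over a finite family of bounded functions. -/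
theorem exists_leastSquares_estimator (hσ2 : 0 < σ2) {n : ℕ} (hn : 1 ≤ n)
    {ι : Type*} [Fintype ι] [Nonempty ι] (g : ι → (ℕ → ℝ) → ℝ) (hg : ∀ i, Measurable (g i))
    (hgB : ∀ i x, |g i x| ≤ B) :
    ∃ Fhat : (Fin n → (ℕ → ℝ) × ℝ) → (ℕ → ℝ) → ℝ,
      Measurable (Function.uncurry Fhat) ∧
      ∀ f : (ℕ → ℝ) → ℝ, Measurable f → (∀ x, |f x| ≤ B) → ∀ i,
        (∫ D, (∫ x, (f x - Fhat D x) ^ 2 ∂P_X)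
          ∂(Measure.pi fun _ : Fin n => regLaw P_X f σ2)) ≤
          (expRate B σ2)⁻¹ * (Real.log (Fintype.card ι) / n +
            1 / (4 * (σ2 : ℝ)) * ∫ x, (f x - g i x) ^ 2 ∂P_X) := by
  classical
  set N := Fintype.card ι with hNdef
  have hN : 0 < N := Fintype.card_pos
  let eqv := Fintype.equivFin ι
  obtain ⟨idx, hidx, hmin⟩ := exists_measurable_argmin hN
    (fun (i : Fin N) (D : Fin n → (ℕ → ℝ) × ℝ) =>
      ∑ m, ((D m).2 - g (eqv.symm i) (D m).1) ^ 2) (fun i => by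
        have := hg (eqv.symm i)
        fun_prop)
  refine ⟨fun D => g (eqv.symm (idx D)), ?_, ?_⟩
  · have h1 : Measurable (fun q : (ℕ → ℝ) × Fin N => g (eqv.symm q.2) q.1) :=
      measurable_from_prod_countable_left fun i => hg (eqv.symm i)
    have h2 : Measurable (fun q : (Fin n → (ℕ → ℝ) × ℝ) × (ℕ → ℝ) => (q.2, idx q.1)) := by
      fun_prop
    exact h1.comp h2
  intro f hf hfB i0
  set c := expRate B σ2 with hc
  have hcpos : 0 < c := expRate_pos hσ2
  set lam := 1 / (4 * (σ2 : ℝ)) with hlam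
  have hlam0 : 0 ≤ lam := by positivity
  have hNR : (0 : ℝ) < N := by exact_mod_cast hN
  have hnR : (0 : ℝ) < n := by exact_mod_cast hn
  have := isProbabilityMeasure_regLaw (P_X := P_X) (σ2 := σ2) hf
  set μ := Measure.pi fun _ : Fin n => regLaw P_X f σ2 with hμ
  let r : ι → ℝ := fun i => ∫ x, (f x - g i x) ^ 2 ∂P_X
  let E : ι → (Fin n → (ℕ → ℝ) × ℝ) → ℝ := fun i D =>
    Real.exp (n * (c * r i)) * ∏ m, Real.exp (-(lam * excess f (g i) (D m)))
  have hEint : ∀ i, Integrable (E i) μ := fun i =>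
    (Integrable.fintype_prod fun _ =>
      (integral_exp_excess hσ2 hf (hg i) hfB (hgB i)).1).const_mul _
  have hEle : ∀ i, ∫ D, E i D ∂μ ≤ 1 := by
    intro i
    rw [integral_const_mul, hμ, integral_fintype_prod_eq_prod (𝕜 := ℝ)
      (fun _ p => Real.exp (-(lam * excess f (g i) p))), Finset.prod_const, Finset.card_univ,
      Fintype.card_fin]
    calc Real.exp (n * (c * r i)) *
          (∫ p, Real.exp (-(lam * excess f (g i) p)) ∂(regLaw P_X f σ2)) ^ n
        ≤ Real.exp (n * (c * r i)) * Real.exp (-(c * r i)) ^ n := by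
          refine mul_le_mul_of_nonneg_left (pow_le_pow_left₀ ?_
            (integral_exp_excess hσ2 hf (hg i) hfB (hgB i)).2 n) (Real.exp_pos _).le
          exact integral_nonneg fun p => (Real.exp_pos (-(lam * excess f (g i) p))).le
      _ = 1 := by
          rw [← Real.exp_nat_mul, ← Real.exp_add]
          simp
  have hEpos : ∀ i D, 0 < E i D := fun i D =>
    mul_pos (Real.exp_pos _) (Finset.prod_pos fun _ _ => Real.exp_pos _)
  have hZint : ∀ m : Fin n, Integrable (fun D : Fin n → (ℕ → ℝ) × ℝ =>
      excess f (g i0) (D m)) μ := fun m =>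
    (measurePreserving_eval (fun _ : Fin n => regLaw P_X f σ2) m).integrable_comp_of_integrable
      (integrable_excess hf (hg i0) hfB (hgB i0)).1
  have hZ : ∀ m : Fin n, ∫ D : Fin n → (ℕ → ℝ) × ℝ, excess f (g i0) (D m) ∂μ = r i0 := by
    intro m
    rw [hμ, integral_comp_eval (integrable_excess hf (hg i0) hfB (hgB i0)).1.aestronglyMeasurable]
    exact (integrable_excess hf (hg i0) hfB (hgB i0)).2
  have hpt : ∀ D, r (eqv.symm (idx D)) ≤ (n * c)⁻¹ * ((Real.log N - 1) +
      ((∑ i, E i D) / N + lam * ∑ m, excess f (g i0) (D m))) := by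
    intro D
    set i := eqv.symm (idx D) with hi
    have hlogE : Real.log (E i D) = n * (c * r i) - lam * ∑ m, excess f (g i) (D m) := by
      simp only [E]
      rw [← Real.exp_sum, ← Real.exp_add, Real.log_exp, Finset.sum_neg_distrib, ← Finset.mul_sum]
      ring
    have h1 : Real.log (E i D) ≤ Real.log N + E i D / N - 1 := by
      have := Real.log_le_sub_one_of_pos (div_pos (hEpos i D) hNR)
      rw [Real.log_div (hEpos i D).ne' hNR.ne'] at this
      linarith
    have h2 : E i D ≤ ∑ i, E i D :=
      Finset.single_le_sum (fun j _ => (hEpos j D).le) (Finset.mem_univ i)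
    have h2' : E i D / N ≤ (∑ i, E i D) / N := by gcongr
    have h3 : ∑ m, excess f (g i) (D m) ≤ ∑ m, excess f (g i0) (D m) := by
      have := hmin D (eqv i0)
      simp only [Equiv.symm_apply_apply] at this
      simp only [excess, Finset.sum_sub_distrib]
      linarith
    have h4 := mul_le_mul_of_nonneg_left h3 hlam0
    rw [inv_mul_eq_div, le_div_iff₀ (by positivity)]
    linarith
  have hI1 : Integrable (fun D => (∑ i, E i D) / N) μ :=
    (integrable_finsetSum _ fun i _ => hEint i).div_const _
  have hI2 : Integrable (fun D => lam * ∑ m, excess f (g i0) (D m)) μ :=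
    (integrable_finsetSum _ fun m _ => hZint m).const_mul _
  have hI3 : Integrable (fun D => (∑ i, E i D) / N + lam * ∑ m, excess f (g i0) (D m)) μ :=
    hI1.add hI2
  have hgi : Integrable (fun D => (n * c)⁻¹ * ((Real.log N - 1) +
      ((∑ i, E i D) / N + lam * ∑ m, excess f (g i0) (D m)))) μ :=
    ((integrable_const _).add hI3).const_mul _
  have hS : ∫ D, ∑ i, E i D ∂μ ≤ N := by
    rw [integral_finsetSum _ fun i _ => hEint i]
    calc ∑ i, ∫ D, E i D ∂μ ≤ ∑ _i : ι, (1 : ℝ) := Finset.sum_le_sum fun i _ => hEle i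
      _ = N := by simp [hNdef]
  calc ∫ D, r (eqv.symm (idx D)) ∂μ
      ≤ ∫ D, (n * c)⁻¹ * ((Real.log N - 1) +
          ((∑ i, E i D) / N + lam * ∑ m, excess f (g i0) (D m))) ∂μ :=
        integral_mono_of_nonneg (ae_of_all _ fun D => integral_nonneg fun x => sq_nonneg _) hgi
          (ae_of_all _ hpt)
    _ = (n * c)⁻¹ * ((Real.log N - 1) + ((∫ D, ∑ i, E i D ∂μ) / N + lam * (n * r i0))) := by
        rw [integral_const_mul, integral_add (integrable_const _) hI3, integral_add hI1 hI2,
          integral_div, integral_const_mul, integral_finsetSum _ fun m _ => hZint m]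
        simp [hZ]
    _ ≤ (n * c)⁻¹ * ((Real.log N - 1) + (1 + lam * (n * r i0))) := by
        gcongr
        rwa [div_le_one hNR]
    _ = _ := by
        field_simp
        ring

end LeastSquares

/-! ### The Markov chain associated with a network -/

section MarkovChain

variable {d : ℕ → ℕ} {W : ℕ → ℕ → ℕ → ℝ}

lemma layerProd_nonneg (hW : ∀ ℓ i j, 0 ≤ W ℓ i j) (a n i j : ℕ) :
    0 ≤ layerProd d W a n i j := by
  induction n generalizing j with
  | zero => simp only [layerProd]; split_ifs <;> norm_num
  | succ n ih => exact Finset.sum_nonneg fun k _ => mul_nonneg (ih k) (hW _ _ _)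

lemma layerProd_succ (a n i k : ℕ) : layerProd d W a (n + 1) i k =
    ∑ j ∈ Finset.range (d (a + n)), layerProd d W a n i j * W (a + n) j k := rfl

lemma layerProd_succ_left (a n : ℕ) {i k : ℕ} (hi : i < d a) (hk : k < d (a + n + 1)) :
    layerProd d W a (n + 1) i k =
      ∑ j ∈ Finset.range (d (a + 1)), W a i j * layerProd d W (a + 1) n j k := by
  induction n generalizing k with
  | zero =>
    simp only [add_zero] at hk
    simp [layerProd, hi, hk]
  | succ n ih =>
    rw [layerProd_succ]
    have h1 : ∀ j ∈ Finset.range (d (a + (n + 1))),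
        layerProd d W a (n + 1) i j * W (a + (n + 1)) j k =
        ∑ l ∈ Finset.range (d (a + 1)),
          W a i l * layerProd d W (a + 1) n l j * W (a + (n + 1)) j k := by
      intro j hj
      rw [ih (Finset.mem_range.1 hj), Finset.sum_mul]
    rw [Finset.sum_congr rfl h1, Finset.sum_comm]
    refine Finset.sum_congr rfl fun l _ => ?_
    rw [layerProd_succ, Finset.mul_sum, show a + 1 + n = a + (n + 1) by ring]
    exact Finset.sum_congr rfl fun j _ => by ring

/-- Row sums of `W ℓ ⋯ W (L-1)`: the total weight of paths from unit `j` of layer `ℓ`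
to the input layer. -/
def inWeight (L : ℕ) (d : ℕ → ℕ) (W : ℕ → ℕ → ℕ → ℝ) (ℓ j : ℕ) : ℝ :=
  ∑ k ∈ Finset.range (d L), layerProd d W ℓ (L - ℓ) j k

lemma inWeight_nonneg {L : ℕ} (hW : ∀ ℓ i j, 0 ≤ W ℓ i j) (ℓ j : ℕ) :
    0 ≤ inWeight L d W ℓ j :=
  Finset.sum_nonneg fun _ _ => layerProd_nonneg hW _ _ _ _

lemma inWeight_last {L j : ℕ} (hj : j < d L) : inWeight L d W L j = 1 := by
  simp [inWeight, layerProd, hj]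

lemma inWeight_eq_sum {L ℓ j : ℕ} (hℓ : ℓ < L) (hj : j < d ℓ) :
    inWeight L d W ℓ j =
      ∑ i ∈ Finset.range (d (ℓ + 1)), W ℓ j i * inWeight L d W (ℓ + 1) i := by
  obtain ⟨n, rfl⟩ : ∃ n, L = ℓ + n + 1 := ⟨L - ℓ - 1, by omega⟩
  simp only [inWeight]
  rw [show ℓ + n + 1 - ℓ = n + 1 by omega, show ℓ + n + 1 - (ℓ + 1) = n by omega]
  rw [Finset.sum_congr rfl fun k hk => layerProd_succ_left ℓ n hj (Finset.mem_range.1 hk),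
    Finset.sum_comm]
  exact Finset.sum_congr rfl fun i _ => by rw [Finset.mul_sum]

/-- Transition probabilities proportional to path weights. -/
def transProb (L : ℕ) (d : ℕ → ℕ) (W : ℕ → ℕ → ℕ → ℝ) (ℓ j i : ℕ) : ℝ :=
  if inWeight L d W ℓ j = 0 then (if i = 0 then 1 else 0)
  else W ℓ j i * inWeight L d W (ℓ + 1) i / inWeight L d W ℓ j

lemma transProb_nonneg {L : ℕ} (hW : ∀ ℓ i j, 0 ≤ W ℓ i j) (ℓ j i : ℕ) :
    0 ≤ transProb L d W ℓ j i := by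
  unfold transProb
  split_ifs
  · exact zero_le_one
  · exact le_rfl
  · exact div_nonneg (mul_nonneg (hW _ _ _) (inWeight_nonneg hW _ _)) (inWeight_nonneg hW _ _)

lemma sum_transProb {L ℓ j : ℕ} (hℓ : ℓ < L) (hj : j < d ℓ) (hd : 0 < d (ℓ + 1)) :
    ∑ i ∈ Finset.range (d (ℓ + 1)), transProb L d W ℓ j i = 1 := by
  unfold transProb
  by_cases h : inWeight L d W ℓ j = 0
  · simp [h, hd]
  · simp only [h, if_false]
    rw [← Finset.sum_div, ← inWeight_eq_sum hℓ hj, div_self h]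

lemma inWeight_mul_transProb {L ℓ j i : ℕ} (hW : ∀ ℓ i j, 0 ≤ W ℓ i j) (hℓ : ℓ < L)
    (hj : j < d ℓ) (hi : i < d (ℓ + 1)) :
    inWeight L d W ℓ j * transProb L d W ℓ j i = W ℓ j i * inWeight L d W (ℓ + 1) i := by
  unfold transProb
  by_cases h : inWeight L d W ℓ j = 0
  · have h0 := inWeight_eq_sum (W := W) hℓ hj
    rw [h] at h0
    have := (Finset.sum_eq_zero_iff_of_nonneg fun i _ =>
      mul_nonneg (hW ℓ j i) (inWeight_nonneg hW (ℓ + 1) i)).1 h0.symm i (Finset.mem_range.2 hi)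
    rw [h, this, zero_mul]
  · simp only [h, if_false]
    field_simp

lemma zRev_eq_inWeight_mul {L d_in : ℕ} (hW : ∀ ℓ i j, 0 ≤ W ℓ i j) (x : ℕ → ℝ) (k : ℕ)
    (hk : k ≤ L) {j : ℕ} (hj : j < d (L - k)) :
    RampNet.zRev L d_in d W x k j =
      inWeight L d W (L - k) j * RampNet.zRev L d_in d (transProb L d W) x k j := by
  induction k generalizing j with
  | zero =>
    rw [Nat.sub_zero] at hj ⊢
    rw [inWeight_last hj, one_mul]
    rfl
  | succ k ih =>
    have hL : L - k = L - (k + 1) + 1 := by omega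
    have hsum : ∑ i ∈ Finset.range (d (L - k)),
        W (L - (k + 1)) j i * RampNet.zRev L d_in d W x k i =
        inWeight L d W (L - (k + 1)) j * ∑ i ∈ Finset.range (d (L - k)),
          transProb L d W (L - (k + 1)) j i *
            RampNet.zRev L d_in d (transProb L d W) x k i := by
      rw [Finset.mul_sum]
      refine Finset.sum_congr rfl fun i hi => ?_
      rw [Finset.mem_range] at hi
      rw [ih (by omega) hi, ← mul_assoc (inWeight _ _ _ _ _),
        inWeight_mul_transProb hW (by omega) hj (by rwa [← hL]), ← hL]
      ring
    have hmax : ∀ t : ℝ, max (inWeight L d W (L - (k + 1)) j * t) 0 =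
        inWeight L d W (L - (k + 1)) j * max t 0 := fun t => by
      rw [mul_max_of_nonneg _ _ (inWeight_nonneg hW _ _), mul_zero]
    simp only [RampNet.zRev]
    rw [hsum, hmax]
    split_ifs <;> ring

lemma abs_zRev_le_one {L d_in : ℕ} {P : ℕ → ℕ → ℕ → ℝ} (hdL : d L = 2 * d_in)
    (hP : ∀ ℓ i j, 0 ≤ P ℓ i j)
    (hsum : ∀ ℓ < L, ∀ j < d ℓ, ∑ i ∈ Finset.range (d (ℓ + 1)), P ℓ j i = 1) {x : ℕ → ℝ}
    (hx : ∀ i < d_in, |x i| ≤ 1) (k : ℕ) (hk : k ≤ L) {j : ℕ} (hj : j < d (L - k)) :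
    |RampNet.zRev L d_in d P x k j| ≤ 1 := by
  induction k generalizing j with
  | zero =>
    rw [Nat.sub_zero, hdL] at hj
    simp only [RampNet.zRev]
    split_ifs with h
    · exact hx _ h
    · rw [abs_neg]
      exact hx _ (by omega)
  | succ k ih =>
    have hL : L - k = L - (k + 1) + 1 := by omega
    have hs : |∑ i ∈ Finset.range (d (L - k)),
        P (L - (k + 1)) j i * RampNet.zRev L d_in d P x k i| ≤ 1 := by
      rw [← hsum (L - (k + 1)) (by omega) j hj, ← hL]
      refine (Finset.abs_sum_le_sum_abs _ _).trans (Finset.sum_le_sum fun i hi => ?_)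
      rw [abs_mul, abs_of_nonneg (hP _ _ _)]
      exact mul_le_of_le_one_right (hP _ _ _) (ih (by omega) (Finset.mem_range.1 hi))
    have hm : |max (∑ i ∈ Finset.range (d (L - k)),
        P (L - (k + 1)) j i * RampNet.zRev L d_in d P x k i) 0| ≤ 1 := by
      rw [abs_of_nonneg (le_max_right _ _)]
      exact max_le ((le_abs_self _).trans hs) zero_le_one
    simp only [RampNet.zRev]
    split_ifs
    · exact hm
    · rwa [abs_neg]

/-- A finite Markov chain started at `0` with prescribed stochastic transition matrices. -/
lemma exists_finite_markovChain {P : ℕ → ℕ → ℕ → ℝ} (hd : d 0 = 1)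
    (hP : ∀ ℓ i j, 0 ≤ P ℓ i j) (L : ℕ)
    (hsum : ∀ ℓ < L, ∀ j < d ℓ, ∑ i ∈ Finset.range (d (ℓ + 1)), P ℓ j i = 1) :
    ∃ (Ω : Type) (_ : Fintype Ω) (p : Ω → ℝ) (X : ℕ → Ω → ℕ), (∀ ω, 0 ≤ p ω) ∧ ∑ ω, p ω = 1 ∧
      (∀ ω, X 0 ω = 0) ∧ (∀ ℓ ≤ L, ∀ ω, X ℓ ω < d ℓ) ∧
      ∀ ℓ < L, ∀ φ : ℕ → ℕ → ℝ, ∑ ω, p ω * φ (X ℓ ω) (X (ℓ + 1) ω) =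
        ∑ ω, p ω * ∑ i ∈ Finset.range (d (ℓ + 1)), P ℓ (X ℓ ω) i * φ (X ℓ ω) i := by
  induction L with
  | zero =>
    exact ⟨Unit, inferInstance, fun _ => 1, fun _ _ => 0, by simp, by simp, by simp,
      by simp [hd], by simp⟩
  | succ L ih =>
    obtain ⟨Ω, _, p, X, hp, hp1, hX0, hXd, hM⟩ := ih fun ℓ hℓ => hsum ℓ (by omega)
    have hlast : ∀ ω, ∑ i : Fin (d (L + 1)), P L (X L ω) i = 1 := fun ω => by
      rw [Fin.sum_univ_eq_sum_range (fun i => P L (X L ω) i)]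
      exact hsum L (by omega) _ (hXd L le_rfl ω)
    have hmarg : ∀ ψ : Ω → ℝ, ∑ q : Ω × Fin (d (L + 1)), p q.1 * P L (X L q.1) q.2 * ψ q.1 =
        ∑ ω, p ω * ψ ω := fun ψ => by
      rw [Fintype.sum_prod_type]
      refine Finset.sum_congr rfl fun ω _ => ?_
      simp only
      rw [← Finset.sum_mul, ← Finset.mul_sum, hlast, mul_one]
    refine ⟨Ω × Fin (d (L + 1)), inferInstance, fun q => p q.1 * P L (X L q.1) q.2,
      fun ℓ q => if ℓ ≤ L then X ℓ q.1 else q.2, fun q => mul_nonneg (hp _) (hP _ _ _), ?_,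
      fun q => by simp [hX0], ?_, ?_⟩
    · have := hmarg fun _ => 1
      simpa [hp1] using this
    · intro ℓ hℓ q
      simp only
      split_ifs with h
      · exact hXd ℓ h _
      · obtain rfl : ℓ = L + 1 := by omega
        exact q.2.2
    · intro ℓ hℓ φ
      rcases Nat.lt_succ_iff_lt_or_eq.1 hℓ with h | rfl
      · have h1 : ℓ ≤ L := h.le
        have h2 : ℓ + 1 ≤ L := h
        simp only [h1, h2, if_true]
        rw [hmarg fun ω => φ (X ℓ ω) (X (ℓ + 1) ω), hM ℓ h φ]
        exact (hmarg fun ω => ∑ i ∈ Finset.range (d (ℓ + 1)), P ℓ (X ℓ ω) i * φ (X ℓ ω) i).symm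
      · simp only [le_refl, if_true, Nat.not_succ_le_self, if_false]
        rw [hmarg fun ω => ∑ i ∈ Finset.range (d (ℓ + 1)), P ℓ (X ℓ ω) i * φ (X ℓ ω) i,
          Fintype.sum_prod_type]
        refine Finset.sum_congr rfl fun ω _ => ?_
        rw [← Fin.sum_univ_eq_sum_range (fun i => P ℓ (X ℓ ω) i * φ (X ℓ ω) i), Finset.mul_sum]
        exact Finset.sum_congr rfl fun i _ => by ring

end MarkovChain

/-! ### Second moments for samples with finite product weights -/

section ProductWeights

variable {Ω : Type*} [Fintype Ω] {p : Ω → ℝ}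

lemma sum_pi_prod_eq_one (hp1 : ∑ ω, p ω = 1) (M : ℕ) :
    ∑ w : Fin M → Ω, ∏ m, p (w m) = 1 := by
  classical
  rw [← Fintype.piFinset_univ, ← Finset.prod_univ_sum (fun _ : Fin M => Finset.univ)
    (fun _ ω => p ω)]
  simp [hp1]

/-- The variance of a sum of independent centred variables is the sum of the variances. -/
lemma sum_pi_prod_mul_sum_sq (hp1 : ∑ ω, p ω = 1) {ζ : Ω → ℝ} (hζ : ∑ ω, p ω * ζ ω = 0)
    (M : ℕ) :
    (∑ w : Fin M → Ω, (∏ m, p (w m)) * ∑ m, ζ (w m) = 0) ∧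
    ∑ w : Fin M → Ω, (∏ m, p (w m)) * (∑ m, ζ (w m)) ^ 2 = M * ∑ ω, p ω * ζ ω ^ 2 := by
  induction M with
  | zero => simp
  | succ M ih =>
    have hcons : ∀ F : (Fin (M + 1) → Ω) → ℝ, ∑ w, F w =
        ∑ ω, ∑ w : Fin M → Ω, F (Fin.cons ω w) := fun F => by
      rw [← (Fin.consEquiv fun _ => Ω).sum_comp F, Fintype.sum_prod_type]
      rfl
    rw [hcons, hcons]
    simp only [Fin.prod_univ_succ, Fin.sum_univ_succ, Fin.cons_zero, Fin.cons_succ]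
    have h1 := sum_pi_prod_eq_one hp1 M
    have e1 : ∀ ω, ∑ w : Fin M → Ω, p ω * (∏ m, p (w m)) * (ζ ω + ∑ m, ζ (w m)) =
        p ω * ζ ω := fun ω => by
      have : ∀ w : Fin M → Ω, p ω * (∏ m, p (w m)) * (ζ ω + ∑ m, ζ (w m)) =
          p ω * ζ ω * (∏ m, p (w m)) + p ω * ((∏ m, p (w m)) * ∑ m, ζ (w m)) :=
        fun w => by ring
      simp only [this]
      rw [Finset.sum_add_distrib, ← Finset.mul_sum, ← Finset.mul_sum, h1, ih.1]
      ring
    have e2 : ∀ ω, ∑ w : Fin M → Ω, p ω * (∏ m, p (w m)) * (ζ ω + ∑ m, ζ (w m)) ^ 2 =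
        p ω * ζ ω ^ 2 + p ω * (M * ∑ ω, p ω * ζ ω ^ 2) := fun ω => by
      have : ∀ w : Fin M → Ω, p ω * (∏ m, p (w m)) * (ζ ω + ∑ m, ζ (w m)) ^ 2 =
          p ω * ζ ω ^ 2 * (∏ m, p (w m)) + 2 * p ω * ζ ω * ((∏ m, p (w m)) * ∑ m, ζ (w m)) +
          p ω * ((∏ m, p (w m)) * (∑ m, ζ (w m)) ^ 2) := fun w => by ring
      simp only [this]
      rw [Finset.sum_add_distrib, Finset.sum_add_distrib, ← Finset.mul_sum, ← Finset.mul_sum,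
        ← Finset.mul_sum, h1, ih.1, ih.2]
      ring
    simp only [e1, e2]
    refine ⟨hζ, ?_⟩
    rw [Finset.sum_add_distrib, ← Finset.sum_mul, hp1]
    push_cast
    ring

/-- Minkowski's inequality for a finite weighted sum. -/
lemma sqrt_sum_mul_sum_sq_le (hp : ∀ ω, 0 ≤ p ω) {κ : Type*} (s : Finset κ) (t : κ → Ω → ℝ) :
    √(∑ ω, p ω * (∑ i ∈ s, t i ω) ^ 2) ≤ ∑ i ∈ s, √(∑ ω, p ω * t i ω ^ 2) := by
  have h : ∀ u : Ω → ℝ, √(∑ ω, p ω * u ω ^ 2) =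
      ‖(WithLp.toLp 2 fun ω => √(p ω) * u ω : EuclideanSpace ℝ Ω)‖ := fun u => by
    rw [EuclideanSpace.norm_eq]
    congr 1
    refine Finset.sum_congr rfl fun ω _ => ?_
    simp only [Real.norm_eq_abs, sq_abs]
    rw [mul_pow, Real.sq_sqrt (hp ω)]
  simp only [h]
  refine le_trans (le_of_eq ?_) (norm_sum_le s _)
  congr 1
  ext ω
  simp [Finset.mul_sum]

end ProductWeights

/-! ### Empirical networks built from sampled paths -/

section EmpiricalNetwork

/-- `±1` according to a Boolean. -/
def boolSign (b : Bool) : ℝ := if b then 1 else -1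

lemma abs_boolSign (b : Bool) : |boolSign b| = 1 := by
  cases b <;> simp [boolSign]

/-- The network on `M` sampled paths.  At level `k + 1` the paths are grouped by the labels
`cls k`, each group averages the outputs of level `k` over its members, and the ramp unit of
path `m` carries the sign `sg k m`.  Level `0` reads the doubled input at `e m`. -/
def empNet (d_in : ℕ) {M : ℕ} (cls : ℕ → Fin M → ℕ) (sg : ℕ → Fin M → Bool) (e : Fin M → ℕ)
    (x : ℕ → ℝ) : ℕ → Fin M → ℝ
  | 0 => fun m => if e m < d_in then x (e m) else -x (e m - d_in)
  | k + 1 => fun m => boolSign (sg k m) *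
      max ((∑ m' with cls k m' = cls k m, empNet d_in cls sg e x k m') /
        (Finset.univ.filter fun m' => cls k m' = cls k m).card) 0

/-- The output of the empirical network: the average over all paths of level `K`. -/
def empOut (d_in : ℕ) {M : ℕ} (cls : ℕ → Fin M → ℕ) (sg : ℕ → Fin M → Bool) (e : Fin M → ℕ)
    (K : ℕ) (x : ℕ → ℝ) : ℝ :=
  (∑ m, empNet d_in cls sg e x K m) / M

variable {d_in M : ℕ}

/-- The empirical network depends only on the partitions induced by the labels, and is
equivariant under permutations of the paths. -/
lemma empNet_congr {cls cls' : ℕ → Fin M → ℕ} {sg sg' : ℕ → Fin M → Bool} {e e' : Fin M → ℕ}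
    (σ : Equiv.Perm (Fin M)) (x : ℕ → ℝ) {K : ℕ}
    (hc : ∀ k < K, ∀ m m', cls' k m = cls' k m' ↔ cls k (σ m) = cls k (σ m'))
    (hs : ∀ k < K, ∀ m, sg' k m = sg k (σ m)) (he : ∀ m, e' m = e (σ m)) (k : ℕ) (hk : k ≤ K)
    (m : Fin M) : empNet d_in cls' sg' e' x k m = empNet d_in cls sg e x k (σ m) := by
  induction k generalizing m with
  | zero => simp [empNet, he]
  | succ k ih =>
    have hf : (Finset.univ.filter fun m' => cls k m' = cls k (σ m)) =
        (Finset.univ.filter fun m' => cls' k m' = cls' k m).map σ.toEmbedding := by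
      ext m'
      simp only [Finset.mem_filter_univ, Finset.mem_map_equiv, hc k hk, Equiv.apply_symm_apply]
    simp only [empNet]
    rw [hs k hk, hf, Finset.card_map, Finset.sum_map]
    simp only [Equiv.coe_toEmbedding]
    rw [Finset.sum_congr rfl fun m' _ => ih (by omega) m']

lemma empOut_congr {cls cls' : ℕ → Fin M → ℕ} {sg sg' : ℕ → Fin M → Bool} {e e' : Fin M → ℕ}
    (σ : Equiv.Perm (Fin M)) (x : ℕ → ℝ) {K : ℕ}
    (hc : ∀ k < K, ∀ m m', cls' k m = cls' k m' ↔ cls k (σ m) = cls k (σ m'))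
    (hs : ∀ k < K, ∀ m, sg' k m = sg k (σ m)) (he : ∀ m, e' m = e (σ m)) :
    empOut d_in cls' sg' e' K x = empOut d_in cls sg e K x := by
  unfold empOut
  rw [Finset.sum_congr rfl fun m _ => empNet_congr σ x hc hs he K le_rfl m]
  rw [Equiv.sum_comp σ (fun m => empNet d_in cls sg e x K m)]

lemma measurable_empNet (cls : ℕ → Fin M → ℕ) (sg : ℕ → Fin M → Bool) (e : Fin M → ℕ) (k : ℕ)
    (m : Fin M) : Measurable fun x => empNet d_in cls sg e x k m := by
  induction k generalizing m with
  | zero =>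
    simp only [empNet]
    split_ifs <;> fun_prop
  | succ k ih =>
    simp only [empNet]
    fun_prop

lemma measurable_empOut (cls : ℕ → Fin M → ℕ) (sg : ℕ → Fin M → Bool) (e : Fin M → ℕ) (K : ℕ) :
    Measurable (empOut d_in cls sg e K) := by
  have := measurable_empNet (d_in := d_in) cls sg e K
  unfold empOut
  fun_prop

lemma abs_empNet_le_one (cls : ℕ → Fin M → ℕ) (sg : ℕ → Fin M → Bool) {e : Fin M → ℕ}
    (he : ∀ m, e m < 2 * d_in) {x : ℕ → ℝ} (hx : ∀ i < d_in, |x i| ≤ 1) (k : ℕ) (m : Fin M) :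
    |empNet d_in cls sg e x k m| ≤ 1 := by
  induction k generalizing m with
  | zero =>
    simp only [empNet]
    split_ifs with h
    · exact hx _ h
    · rw [abs_neg]
      have := he m
      exact hx _ (by omega)
  | succ k ih =>
    simp only [empNet]
    rw [abs_mul, abs_boolSign, one_mul, abs_of_nonneg (le_max_right _ _)]
    refine max_le (div_le_one_of_le₀ ?_ (Nat.cast_nonneg _)) zero_le_one
    refine (Finset.sum_le_card_nsmul _ _ 1 fun m' _ => (le_abs_self _).trans (ih m')).trans ?_
    simp

lemma abs_empOut_le_one (cls : ℕ → Fin M → ℕ) (sg : ℕ → Fin M → Bool) {e : Fin M → ℕ}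
    (he : ∀ m, e m < 2 * d_in) {x : ℕ → ℝ} (hx : ∀ i < d_in, |x i| ≤ 1) (K : ℕ) :
    |empOut d_in cls sg e K x| ≤ 1 := by
  rw [empOut, abs_div, Nat.abs_cast]
  refine div_le_one_of_le₀ ((Finset.abs_sum_le_sum_abs _ _).trans ?_) (Nat.cast_nonneg _)
  refine (Finset.sum_le_card_nsmul _ _ 1 fun m' _ => abs_empNet_le_one cls sg he hx K m').trans ?_
  simp

lemma sum_abs_group_average_sub {D : ℕ} (Y : Fin M → ℕ) (hY : ∀ m, Y m < D) (a : Fin M → ℝ)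
    (μ : ℕ → ℝ) :
    ∑ m, |(∑ m' with Y m' = Y m, a m') / (Finset.univ.filter fun m' => Y m' = Y m).card -
      μ (Y m)| = ∑ j ∈ Finset.range D, |∑ m with Y m = j, (a m - μ j)| := by
  rw [← Finset.sum_fiberwise_of_maps_to (t := Finset.range D) (g := Y)
    fun m _ => Finset.mem_range.2 (hY m)]
  refine Finset.sum_congr rfl fun j _ => ?_
  rw [Finset.sum_congr rfl (g := fun _ => |(∑ m' with Y m' = j, a m') /
    (Finset.univ.filter fun m' => Y m' = j).card - μ j|) fun m hm => by
      rw [(Finset.mem_filter.1 hm).2]]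
  rw [Finset.sum_const, nsmul_eq_mul, Finset.sum_sub_distrib, Finset.sum_const, nsmul_eq_mul]
  set c := (Finset.univ.filter fun m' => Y m' = j).card with hc
  rcases Nat.eq_zero_or_pos c with h0 | h0
  · rw [hc, Finset.card_eq_zero] at h0
    rw [hc, h0]
    simp
  · have hc0 : (0 : ℝ) < c := by exact_mod_cast h0
    rw [← abs_of_pos hc0, ← abs_mul, abs_of_pos hc0]
    congr 1
    field_simp

variable {L : ℕ} {d : ℕ → ℕ}

/-- The sampling fluctuation at unit `j` of the layer at reverse depth `k + 1`. -/
def fluct (L d_in : ℕ) (d : ℕ → ℕ) (P : ℕ → ℕ → ℕ → ℝ) (x : ℕ → ℝ) (k j a b : ℕ) : ℝ :=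
  if a = j then RampNet.zRev L d_in d P x k b -
    ∑ i ∈ Finset.range (d (L - k)), P (L - (k + 1)) j i * RampNet.zRev L d_in d P x k i
  else 0

/-- Labels of sampled paths `Y` by reverse depth. -/
def pathCls (L : ℕ) {M : ℕ} (Y : ℕ → Fin M → ℕ) (k : ℕ) (m : Fin M) : ℕ := Y (L - (k + 1)) m

/-- Signs of the ramp units visited by sampled paths `Y`, by reverse depth. -/
def pathSign (L : ℕ) (d : ℕ → ℕ) {M : ℕ} (Y : ℕ → Fin M → ℕ) (k : ℕ) (m : Fin M) : Bool :=
  decide (Y (L - (k + 1)) m < d (L - (k + 1)) / 2)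

lemma sum_abs_sum_filter_le (P : ℕ → ℕ → ℕ → ℝ) (x : ℕ → ℝ) (Y : ℕ → Fin M → ℕ)
    (k : ℕ) (hY : ∀ m, Y (L - (k + 1)) m < d (L - (k + 1))) (a : Fin M → ℝ) :
    ∑ j ∈ Finset.range (d (L - (k + 1))), |∑ m with Y (L - (k + 1)) m = j, (a m -
      ∑ i ∈ Finset.range (d (L - k)),
        P (L - (k + 1)) j i * RampNet.zRev L d_in d P x k i)| ≤
    ∑ m, |a m - RampNet.zRev L d_in d P x k (Y (L - k) m)| +
      ∑ j ∈ Finset.range (d (L - (k + 1))),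
        |∑ m, fluct L d_in d P x k j (Y (L - (k + 1)) m) (Y (L - k) m)| := by
  rw [← Finset.sum_fiberwise_of_maps_to (t := Finset.range (d (L - (k + 1))))
    (g := Y (L - (k + 1))) (s := Finset.univ) (fun m _ => Finset.mem_range.2 (hY m))
    (fun m => |a m - RampNet.zRev L d_in d P x k (Y (L - k) m)|), ← Finset.sum_add_distrib]
  refine Finset.sum_le_sum fun j _ => ?_
  simp only [fluct]
  rw [← Finset.sum_filter]
  have : ∑ m with Y (L - (k + 1)) m = j, (a m - ∑ i ∈ Finset.range (d (L - k)),
        P (L - (k + 1)) j i * RampNet.zRev L d_in d P x k i) =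
      ∑ m with Y (L - (k + 1)) m = j, (a m - RampNet.zRev L d_in d P x k (Y (L - k) m)) +
      ∑ m with Y (L - (k + 1)) m = j, (RampNet.zRev L d_in d P x k (Y (L - k) m) -
        ∑ i ∈ Finset.range (d (L - k)),
        P (L - (k + 1)) j i * RampNet.zRev L d_in d P x k i) := by
    rw [← Finset.sum_add_distrib]
    exact Finset.sum_congr rfl fun m _ => by ring
  rw [this]
  refine (abs_add_le _ _).trans ?_
  gcongr
  exact Finset.abs_sum_le_sum_abs _ _

/-- Deviation of the empirical network from the network with transition matrices `P`. -/
lemma sum_abs_empNet_sub_le (P : ℕ → ℕ → ℕ → ℝ) (x : ℕ → ℝ) (Y : ℕ → Fin M → ℕ)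
    (hY : ∀ ℓ ≤ L, ∀ m, Y ℓ m < d ℓ) (k : ℕ) (hk : k ≤ L) :
    ∑ m, |empNet d_in (pathCls L Y) (pathSign L d Y) (Y L) x k m -
        RampNet.zRev L d_in d P x k (Y (L - k) m)| ≤
      ∑ k' ∈ Finset.range k, ∑ j ∈ Finset.range (d (L - (k' + 1))),
        |∑ m, fluct L d_in d P x k' j (Y (L - (k' + 1)) m) (Y (L - k') m)| := by
  induction k with
  | zero => simp [empNet, RampNet.zRev]
  | succ k ih =>
    have hY' := hY (L - (k + 1)) (by omega)
    rw [Finset.sum_range_succ]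
    refine le_trans ?_ ((sum_abs_sum_filter_le P x Y k hY'
      (empNet d_in (pathCls L Y) (pathSign L d Y) (Y L) x k)).trans
      (add_le_add_left (ih (by omega)) _))
    rw [← sum_abs_group_average_sub _ hY' _ (fun j => ∑ i ∈ Finset.range (d (L - k)),
        P (L - (k + 1)) j i * RampNet.zRev L d_in d P x k i)]
    refine Finset.sum_le_sum fun m _ => ?_
    have hz : RampNet.zRev L d_in d P x (k + 1) (Y (L - (k + 1)) m) =
        boolSign (pathSign L d Y k m) * max (∑ i ∈ Finset.range (d (L - k)),
          P (L - (k + 1)) (Y (L - (k + 1)) m) i * RampNet.zRev L d_in d P x k i) 0 := by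
      simp only [RampNet.zRev, boolSign, pathSign, decide_eq_true_eq]
      by_cases h : Y (L - (k + 1)) m < d (L - (k + 1)) / 2
      · simp only [h, if_true, one_mul]
      · simp only [h, if_false, neg_one_mul]
    rw [hz]
    simp only [empNet]
    rw [← mul_sub, abs_mul, abs_boolSign, one_mul]
    exact abs_max_sub_max_le_abs _ _ _

/-- Deviation of the averaged output of the empirical network. -/
lemma abs_empOut_sub_le (P : ℕ → ℕ → ℕ → ℝ) (x : ℕ → ℝ) (Y : ℕ → Fin M → ℕ) (hM : 0 < M)
    (hL : 1 ≤ L) (hd : d 0 = 1) (hY : ∀ ℓ ≤ L, ∀ m, Y ℓ m < d ℓ) :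
    |empOut d_in (pathCls L Y) (pathSign L d Y) (Y L) (L - 1) x -
        ∑ i ∈ Finset.range (d 1), P 0 0 i * RampNet.zRev L d_in d P x (L - 1) i| ≤
      (∑ k ∈ Finset.range L, ∑ j ∈ Finset.range (d (L - (k + 1))),
        |∑ m, fluct L d_in d P x k j (Y (L - (k + 1)) m) (Y (L - k) m)|) / M := by
  obtain ⟨n, rfl⟩ : ∃ n, L = n + 1 := ⟨L - 1, by omega⟩
  have hMR : (0 : ℝ) < M := by exact_mod_cast hM
  rw [le_div_iff₀ hMR, Finset.sum_range_succ]
  have hY' := hY (n + 1 - (n + 1)) (by omega)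
  refine le_trans ?_ ((sum_abs_sum_filter_le P x Y n hY'
      (empNet d_in (pathCls (n + 1) Y) (pathSign (n + 1) d Y) (Y (n + 1)) x n)).trans
      (add_le_add_left (sum_abs_empNet_sub_le P x Y hY n (by omega)) _))
  have hY0 : ∀ m, Y 0 m = 0 := fun m => by
    have := hY 0 (by omega) m
    omega
  have e1 : n + 1 - (n + 1) = 0 := by omega
  have e2 : n + 1 - n = 1 := by omega
  have e3 : n + 1 - 1 = n := by omega
  rw [e1, e2, e3, hd]
  simp only [Finset.range_one, Finset.sum_singleton, hY0, Finset.filter_true]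
  rw [Finset.sum_sub_distrib, Finset.sum_const, Finset.card_univ, Fintype.card_fin, nsmul_eq_mul]
  refine le_of_eq ?_
  have habs : ∀ t : ℝ, |t| * M = |t * M| := fun t => by rw [abs_mul, abs_of_pos hMR]
  rw [habs, empOut]
  congr 1
  field_simp

end EmpiricalNetwork

/-! ### Approximation of a network by an empirical one -/

section Sampling

variable {L d_in : ℕ} {d : ℕ → ℕ}

lemma measurable_zRev (W : ℕ → ℕ → ℕ → ℝ) (k j : ℕ) :
    Measurable fun x => RampNet.zRev L d_in d W x k j := by
  induction k generalizing j with
  | zero =>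
    simp only [RampNet.zRev]
    split_ifs <;> fun_prop
  | succ k ih =>
    simp only [RampNet.zRev]
    split_ifs <;> fun_prop

lemma measurable_eval (net : RampNet L d_in d) : Measurable net.eval := by
  have := measurable_zRev (L := L) (d_in := d_in) (d := d) net.W (L - 1)
  unfold RampNet.eval
  fun_prop

lemma Vin_eq (net : RampNet L d_in d) (ℓ : ℕ) :
    net.Vin ℓ = ∑ j ∈ Finset.range (d ℓ), inWeight L d net.W ℓ j := by
  simp only [RampNet.Vin, ell1, inWeight]
  refine Finset.sum_congr rfl fun i _ => Finset.sum_congr rfl fun j _ => ?_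
  exact abs_of_nonneg (layerProd_nonneg net.W_nonneg _ _ _ _)

lemma Vout_eq (net : RampNet L d_in d) (hd : d 0 = 1) (ℓ : ℕ) :
    net.Vout ℓ = ∑ j ∈ Finset.range (d ℓ), net.w0 * layerProd d net.W 0 ℓ 0 j := by
  rw [RampNet.Vout, ell1, hd, Finset.sum_range_one, Finset.mul_sum]
  refine Finset.sum_congr rfl fun j _ => ?_
  rw [abs_of_nonneg (layerProd_nonneg net.W_nonneg _ _ _ _)]

lemma Vtot_eq (net : RampNet L d_in d) (hd : d 0 = 1) :
    net.Vtot = net.w0 * inWeight L d net.W 0 0 := by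
  rw [RampNet.Vtot, ell1, hd, Finset.sum_range_one, inWeight, Nat.sub_zero]
  congr 1
  exact Finset.sum_congr rfl fun j _ => abs_of_nonneg (layerProd_nonneg net.W_nonneg _ _ _ _)

lemma Vtot_nonneg (net : RampNet L d_in d) (hd : d 0 = 1) : 0 ≤ net.Vtot := by
  rw [Vtot_eq net hd]
  exact mul_nonneg net.w0_nonneg (inWeight_nonneg net.W_nonneg _ _)

lemma mul_compVar (net : RampNet L d_in d) (hd : d 0 = 1) (hL : 1 ≤ L) :
    L * net.compVar = √net.Vtot * ∑ ℓ ∈ Finset.range L, ∑ j ∈ Finset.range (d ℓ),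
      (net.w0 * layerProd d net.W 0 ℓ 0 j + inWeight L d net.W ℓ j) / 2 := by
  have hLR : (0 : ℝ) < L := by exact_mod_cast hL
  rw [RampNet.compVar, RampNet.Vbar]
  have : ∀ ℓ, (net.Vout ℓ + net.Vin ℓ) / 2 = ∑ j ∈ Finset.range (d ℓ),
      (net.w0 * layerProd d net.W 0 ℓ 0 j + inWeight L d net.W ℓ j) / 2 := fun ℓ => by
    rw [Vin_eq, Vout_eq _ hd, ← Finset.sum_add_distrib, Finset.sum_div]
  simp only [this]
  field_simp

lemma eval_eq_Vtot_mul (net : RampNet L d_in d) (hd : d 0 = 1) (hL : 1 ≤ L) (x : ℕ → ℝ) :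
    net.eval x = net.Vtot * ∑ i ∈ Finset.range (d 1), transProb L d net.W 0 0 i *
      RampNet.zRev L d_in d (transProb L d net.W) x (L - 1) i := by
  rw [RampNet.eval, Vtot_eq net hd, mul_assoc, Finset.mul_sum (a := inWeight _ _ _ _ _)]
  congr 1
  refine Finset.sum_congr rfl fun i hi => ?_
  rw [Finset.mem_range] at hi
  have h1 : L - (L - 1) = 1 := by omega
  rw [zRev_eq_inWeight_mul net.W_nonneg x (L - 1) (by omega) (by rwa [h1]), h1, ← mul_assoc,
    ← mul_assoc, inWeight_mul_transProb net.W_nonneg (by omega) (by omega) hi]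

lemma sum_stochastic_abs_le {D : ℕ} {q z : ℕ → ℝ} (hq : ∀ i, 0 ≤ q i)
    (hq1 : ∑ i ∈ Finset.range D, q i = 1) (hz : ∀ i < D, |z i| ≤ 1) :
    |∑ i ∈ Finset.range D, q i * z i| ≤ 1 := by
  rw [← hq1]
  refine (Finset.abs_sum_le_sum_abs _ _).trans (Finset.sum_le_sum fun i hi => ?_)
  rw [abs_mul, abs_of_nonneg (hq i)]
  exact mul_le_of_le_one_right (hq i) (hz i (Finset.mem_range.1 hi))

lemma abs_eval_le_Vtot (net : RampNet L d_in d) (hd : d 0 = 1) (hdL : d L = 2 * d_in)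
    (hpos : ∀ ℓ ≤ L, 0 < d ℓ) (hL : 1 ≤ L) {x : ℕ → ℝ} (hx : ∀ i < d_in, |x i| ≤ 1) :
    |net.eval x| ≤ net.Vtot := by
  rw [eval_eq_Vtot_mul net hd hL, abs_mul, abs_of_nonneg (Vtot_nonneg net hd)]
  refine mul_le_of_le_one_right (Vtot_nonneg net hd) ?_
  have hP := transProb_nonneg (L := L) (d := d) net.W_nonneg
  have hsum : ∀ ℓ < L, ∀ j < d ℓ, ∑ i ∈ Finset.range (d (ℓ + 1)),
      transProb L d net.W ℓ j i = 1 := fun ℓ hℓ j hj => sum_transProb hℓ hj (hpos _ hℓ)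
  refine sum_stochastic_abs_le (hP 0 0) (hsum 0 (by omega) 0 (by omega)) fun i hi => ?_
  exact abs_zRev_le_one hdL hP hsum hx (L - 1) (by omega)
    (by rwa [show L - (L - 1) = 1 by omega])

/-- Marginals of the network Markov chain. -/
lemma inWeight_mul_marginal {W : ℕ → ℕ → ℕ → ℝ} (hd : d 0 = 1)
    (hW : ∀ ℓ i j, 0 ≤ W ℓ i j) {Ω : Type*} [Fintype Ω] {p : Ω → ℝ} {X : ℕ → Ω → ℕ}
    (hp1 : ∑ ω, p ω = 1) (hX0 : ∀ ω, X 0 ω = 0) (hXd : ∀ ℓ ≤ L, ∀ ω, X ℓ ω < d ℓ)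
    (hM : ∀ ℓ < L, ∀ φ : ℕ → ℕ → ℝ, ∑ ω, p ω * φ (X ℓ ω) (X (ℓ + 1) ω) =
        ∑ ω, p ω * ∑ i ∈ Finset.range (d (ℓ + 1)),
          transProb L d W ℓ (X ℓ ω) i * φ (X ℓ ω) i)
    (ℓ : ℕ) (hℓ : ℓ ≤ L) {j : ℕ} (hj : j < d ℓ) :
    inWeight L d W 0 0 * ∑ ω, p ω * (if X ℓ ω = j then 1 else 0) =
      layerProd d W 0 ℓ 0 j * inWeight L d W ℓ j := by
  induction ℓ generalizing j with
  | zero =>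
    obtain rfl : j = 0 := by omega
    simp [hX0, hp1, layerProd]
  | succ ℓ ih =>
    rw [hM ℓ hℓ fun _ b => if b = j then 1 else 0]
    have h1 : ∀ ω, ∑ i ∈ Finset.range (d (ℓ + 1)),
        transProb L d W ℓ (X ℓ ω) i * (if i = j then 1 else 0) =
        ∑ i ∈ Finset.range (d ℓ), (if X ℓ ω = i then 1 else 0) * transProb L d W ℓ i j := by
      intro ω
      simp [hj, hXd ℓ (by omega) ω]
    simp only [h1]
    rw [Finset.sum_congr rfl fun ω _ => Finset.mul_sum _ _ _, Finset.sum_comm, Finset.mul_sum,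
      layerProd_succ, zero_add, Finset.sum_mul]
    refine Finset.sum_congr rfl fun i hi => ?_
    rw [Finset.mem_range] at hi
    have h2 := ih (by omega) hi
    have h3 := inWeight_mul_transProb hW hℓ hi hj
    calc inWeight L d W 0 0 * ∑ ω, p ω * ((if X ℓ ω = i then 1 else 0) * transProb L d W ℓ i j)
        = (inWeight L d W 0 0 * ∑ ω, p ω * (if X ℓ ω = i then 1 else 0)) *
            transProb L d W ℓ i j := by
          rw [mul_assoc, Finset.sum_mul]
          simp only [mul_assoc]
      _ = _ := by rw [h2, mul_assoc, h3, ← mul_assoc]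

/-- Mean square error of the empirical network at a fixed input. -/
lemma sum_mul_sq_eval_sub_le (net : RampNet L d_in d) (hd : d 0 = 1) (hdL : d L = 2 * d_in)
    (hpos : ∀ ℓ ≤ L, 0 < d ℓ) (hL : 1 ≤ L) {Ω : Type*} [Fintype Ω] {p : Ω → ℝ}
    {X : ℕ → Ω → ℕ} (hp : ∀ ω, 0 ≤ p ω) (hp1 : ∑ ω, p ω = 1) (hX0 : ∀ ω, X 0 ω = 0)
    (hXd : ∀ ℓ ≤ L, ∀ ω, X ℓ ω < d ℓ)
    (hMk : ∀ ℓ < L, ∀ φ : ℕ → ℕ → ℝ, ∑ ω, p ω * φ (X ℓ ω) (X (ℓ + 1) ω) =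
        ∑ ω, p ω * ∑ i ∈ Finset.range (d (ℓ + 1)),
          transProb L d net.W ℓ (X ℓ ω) i * φ (X ℓ ω) i)
    {M : ℕ} (hM : 0 < M) {x : ℕ → ℝ} (hx : ∀ i < d_in, |x i| ≤ 1) :
    ∑ w : Fin M → Ω, (∏ m, p (w m)) * (net.eval x - net.Vtot *
        empOut d_in (pathCls L fun ℓ m => X ℓ (w m)) (pathSign L d fun ℓ m => X ℓ (w m))
          (fun m => X L (w m)) (L - 1) x) ^ 2 ≤ (2 * (L * net.compVar)) ^ 2 / M := by
  classical
  set P := transProb L d net.W with hPdef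
  have hP : ∀ ℓ i j, 0 ≤ P ℓ i j := transProb_nonneg (L := L) (d := d) net.W_nonneg
  have hsum : ∀ ℓ < L, ∀ j < d ℓ, ∑ i ∈ Finset.range (d (ℓ + 1)), P ℓ j i = 1 :=
    fun ℓ hℓ j hj => sum_transProb hℓ hj (hpos _ hℓ)
  have hMR : (0 : ℝ) < M := by exact_mod_cast hM
  have hV0 := Vtot_nonneg net hd
  set V := net.Vtot with hV
  have hq : ∀ w : Fin M → Ω, 0 ≤ ∏ m, p (w m) := fun w => Finset.prod_nonneg fun _ _ => hp _
  let ζ : ℕ → ℕ → Ω → ℝ := fun k j ω =>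
    fluct L d_in d P x k j (X (L - (k + 1)) ω) (X (L - k) ω)
  have hmean : ∀ k < L, ∀ j < d (L - (k + 1)), ∑ ω, p ω * ζ k j ω = 0 := by
    intro k hk j hj
    have hk1 : L - k = L - (k + 1) + 1 := by omega
    have h := hMk (L - (k + 1)) (by omega) (fluct L d_in d P x k j)
    rw [← hk1] at h
    rw [h]
    refine Finset.sum_eq_zero fun ω _ => ?_
    by_cases hj' : X (L - (k + 1)) ω = j
    · have h1 := hsum (L - (k + 1)) (by omega) j hj
      rw [← hk1] at h1
      simp only [fluct, hj', if_true, mul_sub]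
      rw [Finset.sum_sub_distrib, ← Finset.sum_mul, h1]
      ring
    · simp [fluct, hj']
  have hsq : ∀ k < L, ∀ j < d (L - (k + 1)), ∑ ω, p ω * ζ k j ω ^ 2 ≤
      4 * ∑ ω, p ω * (if X (L - (k + 1)) ω = j then 1 else 0) := by
    intro k hk j hj
    have hk1 : L - k = L - (k + 1) + 1 := by omega
    rw [Finset.mul_sum]
    refine Finset.sum_le_sum fun ω _ => ?_
    simp only [ζ, fluct]
    split_ifs with h
    · have h1 : |RampNet.zRev L d_in d P x k (X (L - k) ω)| ≤ 1 :=
        abs_zRev_le_one hdL hP hsum hx k hk.le (hXd _ (by omega) _)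
      have h2 : |∑ i ∈ Finset.range (d (L - k)), P (L - (k + 1)) j i *
          RampNet.zRev L d_in d P x k i| ≤ 1 := by
        refine sum_stochastic_abs_le (hP _ _) ?_ fun i hi =>
          abs_zRev_le_one hdL hP hsum hx k hk.le hi
        rw [hk1]
        exact hsum _ (by omega) j hj
      have h3 := abs_le.1 h1
      have h4 := abs_le.1 h2
      nlinarith [hp ω, mul_nonneg (hp ω) (mul_nonneg
        (sub_nonneg.2 (by linarith [h3.2, h4.1] : RampNet.zRev L d_in d P x k (X (L - k) ω) -
          ∑ i ∈ Finset.range (d (L - k)), P (L - (k + 1)) j i *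
          RampNet.zRev L d_in d P x k i ≤ 2))
        (by linarith [h3.1, h4.2] : 0 ≤ 2 + (RampNet.zRev L d_in d P x k (X (L - k) ω) -
          ∑ i ∈ Finset.range (d (L - k)), P (L - (k + 1)) j i *
          RampNet.zRev L d_in d P x k i)))]
    · simp
  have hterm : ∀ k < L, ∀ j < d (L - (k + 1)),
      V / M * √(∑ w : Fin M → Ω, (∏ m, p (w m)) * |∑ m, ζ k j (w m)| ^ 2) ≤
      2 * √V / √M * ((net.w0 * layerProd d net.W 0 (L - (k + 1)) 0 j +
        inWeight L d net.W (L - (k + 1)) j) / 2) := by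
    intro k hk j hj
    simp only [sq_abs]
    rw [(sum_pi_prod_mul_sum_sq hp1 (hmean k hk j hj) M).2]
    set a := ∑ ω, p ω * (if X (L - (k + 1)) ω = j then (1 : ℝ) else 0) with ha
    have ha0 : 0 ≤ a := Finset.sum_nonneg fun ω _ => mul_nonneg (hp ω) (by split_ifs <;> norm_num)
    have hmarg := inWeight_mul_marginal hd net.W_nonneg hp1 hX0 hXd hMk (L - (k + 1)) (by omega) hj
    rw [← ha] at hmarg
    set α := layerProd d net.W 0 (L - (k + 1)) 0 j
    set β := inWeight L d net.W (L - (k + 1)) j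
    have hβ : 0 ≤ β := inWeight_nonneg net.W_nonneg _ _
    have hα : 0 ≤ α := layerProd_nonneg net.W_nonneg _ _ _ _
    have hVa : V * a = (net.w0 * α) * β := by
      rw [hV, Vtot_eq net hd, mul_assoc, hmarg, mul_assoc]
    have hgm : √(V * a) ≤ (net.w0 * α + β) / 2 := by
      rw [hVa]
      refine Real.sqrt_le_iff.2 ⟨by have := net.w0_nonneg; positivity, ?_⟩
      nlinarith [sq_nonneg (net.w0 * α - β)]
    calc V / M * √(M * ∑ ω, p ω * ζ k j ω ^ 2)
        ≤ V / M * √(M * (4 * a)) := by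
          gcongr
          exact hsq k hk j hj
      _ = 2 * √V / √M * √(V * a) := by
          rw [Real.sqrt_mul hMR.le, Real.sqrt_mul (by norm_num : (0 : ℝ) ≤ 4), Real.sqrt_mul hV0,
            show (4 : ℝ) = 2 ^ 2 by norm_num, Real.sqrt_sq (by norm_num)]
          have hsM : √(M : ℝ) ≠ 0 := (Real.sqrt_pos.2 hMR).ne'
          have e1 : (M : ℝ) = √M * √M := (Real.mul_self_sqrt hMR.le).symm
          have e2 : V = √V * √V := (Real.mul_self_sqrt hV0).symm
          generalize √(M : ℝ) = sM at *
          generalize √V = sV at *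
          rw [e1, e2]
          field_simp
      _ ≤ _ := by gcongr
  set T : (Fin M → Ω) → ℝ := fun w => ∑ k ∈ Finset.range L,
    ∑ j ∈ Finset.range (d (L - (k + 1))), |∑ m, ζ k j (w m)| with hT
  have hdev : ∀ w : Fin M → Ω, (net.eval x - V *
        empOut d_in (pathCls L fun ℓ m => X ℓ (w m)) (pathSign L d fun ℓ m => X ℓ (w m))
          (fun m => X L (w m)) (L - 1) x) ^ 2 ≤ (V / M * T w) ^ 2 := by
    intro w
    have h := abs_empOut_sub_le (d_in := d_in) P x (fun ℓ m => X ℓ (w m)) hM hL hd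
      (fun ℓ hℓ m => hXd ℓ hℓ _)
    have hT0 : 0 ≤ T w := Finset.sum_nonneg fun k _ => Finset.sum_nonneg fun j _ => abs_nonneg _
    rw [eval_eq_Vtot_mul net hd hL, ← mul_sub, sq_le_sq, abs_mul, abs_of_nonneg hV0,
      abs_of_nonneg (by positivity : 0 ≤ V / M * T w), abs_sub_comm, div_mul_eq_mul_div,
      mul_div_assoc]
    exact mul_le_mul_of_nonneg_left h hV0
  have hsqrt : √(∑ w : Fin M → Ω, (∏ m, p (w m)) * (V / M * T w) ^ 2) ≤
      2 * (L * net.compVar) / √M := by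
    have e1 : ∑ w : Fin M → Ω, (∏ m, p (w m)) * (V / M * T w) ^ 2 =
        (V / M) ^ 2 * ∑ w : Fin M → Ω, (∏ m, p (w m)) * T w ^ 2 := by
      rw [Finset.mul_sum]
      exact Finset.sum_congr rfl fun w _ => by ring
    rw [e1, Real.sqrt_mul (by positivity), Real.sqrt_sq (by positivity)]
    calc V / M * √(∑ w : Fin M → Ω, (∏ m, p (w m)) * T w ^ 2)
        ≤ V / M * ∑ k ∈ Finset.range L, ∑ j ∈ Finset.range (d (L - (k + 1))),
            √(∑ w : Fin M → Ω, (∏ m, p (w m)) * |∑ m, ζ k j (w m)| ^ 2) := by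
          gcongr
          refine (sqrt_sum_mul_sum_sq_le hq _ _).trans (Finset.sum_le_sum fun k _ => ?_)
          exact sqrt_sum_mul_sum_sq_le hq _ _
      _ ≤ ∑ k ∈ Finset.range L, ∑ j ∈ Finset.range (d (L - (k + 1))),
            2 * √V / √M * ((net.w0 * layerProd d net.W 0 (L - (k + 1)) 0 j +
              inWeight L d net.W (L - (k + 1)) j) / 2) := by
          rw [Finset.mul_sum]
          refine Finset.sum_le_sum fun k hk => ?_
          rw [Finset.mul_sum]
          exact Finset.sum_le_sum fun j hj =>
            hterm k (Finset.mem_range.1 hk) j (Finset.mem_range.1 hj)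
      _ = ∑ ℓ ∈ Finset.range L, ∑ j ∈ Finset.range (d ℓ),
            2 * √V / √M * ((net.w0 * layerProd d net.W 0 ℓ 0 j +
              inWeight L d net.W ℓ j) / 2) := by
          rw [← Finset.sum_range_reflect (fun ℓ => ∑ j ∈ Finset.range (d ℓ),
            2 * √V / √M * ((net.w0 * layerProd d net.W 0 ℓ 0 j +
              inWeight L d net.W ℓ j) / 2))]
          refine Finset.sum_congr rfl fun k _ => ?_
          rw [show L - 1 - k = L - (k + 1) by omega]
      _ = 2 * (L * net.compVar) / √M := by
          rw [mul_compVar net hd hL, ← hV]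
          simp only [← Finset.mul_sum]
          ring
  calc _ ≤ ∑ w : Fin M → Ω, (∏ m, p (w m)) * (V / M * T w) ^ 2 :=
        Finset.sum_le_sum fun w _ => mul_le_mul_of_nonneg_left (hdev w) (hq w)
    _ = √(∑ w : Fin M → Ω, (∏ m, p (w m)) * (V / M * T w) ^ 2) ^ 2 :=
        (Real.sq_sqrt (Finset.sum_nonneg fun w _ => mul_nonneg (hq w) (sq_nonneg _))).symm
    _ ≤ (2 * (L * net.compVar) / √M) ^ 2 := by gcongr
    _ = _ := by rw [div_pow, Real.sq_sqrt hMR.le]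

/-- Some sample of `M` paths approximates the network to order `M^{-1/2}` in `L²`. -/
theorem exists_empOut_approx (net : RampNet L d_in d) (hd : d 0 = 1) (hdL : d L = 2 * d_in)
    (hpos : ∀ ℓ ≤ L, 0 < d ℓ) (hL : 1 ≤ L) {M : ℕ} (hM : 0 < M) (P_X : Measure (ℕ → ℝ))
    [IsProbabilityMeasure P_X] (hcube : ∀ᵐ x ∂P_X, ∀ i < d_in, |x i| ≤ 1) :
    ∃ Y : ℕ → Fin M → ℕ, (∀ ℓ ≤ L, ∀ m, Y ℓ m < d ℓ) ∧
      ∫ x, (net.eval x - net.Vtot *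
        empOut d_in (pathCls L Y) (pathSign L d Y) (Y L) (L - 1) x) ^ 2 ∂P_X ≤
        (2 * (L * net.compVar)) ^ 2 / M := by
  obtain ⟨Ω, _, p, X, hp, hp1, hX0, hXd, hMk⟩ := exists_finite_markovChain (d := d) hd
    (transProb_nonneg (L := L) (d := d) net.W_nonneg) L
    fun ℓ hℓ j hj => sum_transProb hℓ hj (hpos _ hℓ)
  set b := (2 * (L * net.compVar)) ^ 2 / (M : ℝ)
  let F : (Fin M → Ω) → (ℕ → ℝ) → ℝ := fun w x => (net.eval x - net.Vtot *
        empOut d_in (pathCls L fun ℓ m => X ℓ (w m)) (pathSign L d fun ℓ m => X ℓ (w m))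
          (fun m => X L (w m)) (L - 1) x) ^ 2
  have hq : ∀ w : Fin M → Ω, 0 ≤ ∏ m, p (w m) := fun w => Finset.prod_nonneg fun _ _ => hp _
  have hq1 := sum_pi_prod_eq_one hp1 M
  have hV0 := Vtot_nonneg net hd
  have hFint : ∀ w, Integrable (F w) P_X := by
    intro w
    refine Integrable.of_bound (C := (net.Vtot + net.Vtot * 1) ^ 2) ?_ ?_
    · have h1 := measurable_eval net
      have h2 := measurable_empOut (d_in := d_in) (pathCls L fun ℓ m => X ℓ (w m))
        (pathSign L d fun ℓ m => X ℓ (w m)) (fun m => X L (w m)) (L - 1)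
      apply Measurable.aestronglyMeasurable
      fun_prop
    · filter_upwards [hcube] with x hx
      rw [Real.norm_eq_abs, abs_pow]
      have h1 := abs_eval_le_Vtot net hd hdL hpos hL hx
      have h2 := abs_empOut_le_one (pathCls L fun ℓ m => X ℓ (w m))
        (pathSign L d fun ℓ m => X ℓ (w m)) (e := fun m => X L (w m))
        (fun m => hdL ▸ hXd L le_rfl _) hx (L - 1)
      refine pow_le_pow_left₀ (abs_nonneg _) ((abs_sub _ _).trans ?_) 2
      rw [abs_mul, abs_of_nonneg hV0]
      gcongr
  have hexp : ∑ w : Fin M → Ω, (∏ m, p (w m)) * ∫ x, F w x ∂P_X ≤ b := by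
    simp only [← integral_const_mul]
    rw [← integral_finsetSum _ fun w _ => (hFint w).const_mul _]
    calc ∫ x, ∑ w : Fin M → Ω, (∏ m, p (w m)) * F w x ∂P_X ≤ ∫ _x, b ∂P_X := by
          refine integral_mono_ae (integrable_finsetSum _ fun w _ => (hFint w).const_mul _)
            (integrable_const _) ?_
          filter_upwards [hcube] with x hx
          exact sum_mul_sq_eval_sub_le net hd hdL hpos hL hp hp1 hX0 hXd hMk hM hx
      _ = b := by simp
  obtain ⟨w, hw⟩ : ∃ w, ∫ x, F w x ∂P_X ≤ b := by
    by_contra! hcon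
    have h1 : ∑ w : Fin M → Ω, (∏ m, p (w m)) * (∫ x, F w x ∂P_X - b) ≤ 0 := by
      simp only [mul_sub]
      rw [Finset.sum_sub_distrib, ← Finset.sum_mul, hq1]
      linarith
    have h2 := (Finset.sum_eq_zero_iff_of_nonneg fun w _ =>
      mul_nonneg (hq w) (sub_nonneg.2 (hcon w).le)).1 (le_antisymm h1
        (Finset.sum_nonneg fun w _ => mul_nonneg (hq w) (sub_nonneg.2 (hcon w).le)))
    have h3 : ∑ w : Fin M → Ω, ∏ m, p (w m) = 0 := Finset.sum_eq_zero fun w hw =>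
      (mul_eq_zero.1 (h2 w hw)).resolve_right (sub_pos.2 (hcon w)).ne'
    rw [hq1] at h3
    exact one_ne_zero h3
  exact ⟨fun ℓ m => X ℓ (w m), fun ℓ hℓ m => hXd ℓ hℓ _, hw⟩

end Sampling

/-! ### Finite encoding of empirical networks -/

section Encoding

lemma inWeight_zero_eq_sum {L : ℕ} {d : ℕ → ℕ} (W : ℕ → ℕ → ℕ → ℝ) (hd : d 0 = 1) (ℓ : ℕ)
    (hℓ : ℓ ≤ L) : inWeight L d W 0 0 =
      ∑ j ∈ Finset.range (d ℓ), layerProd d W 0 ℓ 0 j * inWeight L d W ℓ j := by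
  induction ℓ with
  | zero => simp [hd, layerProd]
  | succ ℓ ih =>
    rw [ih (by omega), Finset.sum_congr rfl fun j hj => by
      rw [inWeight_eq_sum (by omega) (Finset.mem_range.1 hj), Finset.mul_sum], Finset.sum_comm]
    refine Finset.sum_congr rfl fun i _ => ?_
    rw [layerProd_succ, zero_add, Finset.sum_mul]
    exact Finset.sum_congr rfl fun j _ => by ring

lemma Vtot_le_Vout_mul_Vin {L d_in : ℕ} {d : ℕ → ℕ} (net : RampNet L d_in d) (hd : d 0 = 1)
    {ℓ : ℕ} (hℓ : ℓ ≤ L) : net.Vtot ≤ net.Vout ℓ * net.Vin ℓ := by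
  have hα : ∀ j, 0 ≤ net.w0 * layerProd d net.W 0 ℓ 0 j := fun j =>
    mul_nonneg net.w0_nonneg (layerProd_nonneg net.W_nonneg _ _ _ _)
  have hβ : ∀ j, 0 ≤ inWeight L d net.W ℓ j := inWeight_nonneg net.W_nonneg ℓ
  rw [Vtot_eq net hd, Vout_eq net hd, Vin_eq, inWeight_zero_eq_sum net.W hd ℓ hℓ, Finset.mul_sum,
    Finset.sum_mul]
  refine Finset.sum_le_sum fun j hj => ?_
  rw [← mul_assoc]
  exact mul_le_mul_of_nonneg_left
    (Finset.single_le_sum (f := inWeight L d net.W ℓ) (fun i _ => hβ i) hj) (hα j)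

lemma Vtot_le_compVar {L d_in : ℕ} {d : ℕ → ℕ} (net : RampNet L d_in d) (hd : d 0 = 1)
    (hL : 1 ≤ L) : net.Vtot ≤ net.compVar := by
  have hLR : (0 : ℝ) < L := by exact_mod_cast hL
  have hV := Vtot_nonneg net hd
  have hterm : ∀ ℓ ∈ Finset.range L, √net.Vtot ≤ (net.Vout ℓ + net.Vin ℓ) / 2 := by
    intro ℓ hℓ
    have h1 := Vtot_le_Vout_mul_Vin net hd (Finset.mem_range.1 hℓ).le
    have h2 : 0 ≤ net.Vin ℓ := by
      rw [Vin_eq]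
      exact Finset.sum_nonneg fun j _ => inWeight_nonneg net.W_nonneg ℓ j
    have h3 : 0 ≤ net.Vout ℓ := by
      rw [Vout_eq net hd]
      exact Finset.sum_nonneg fun j _ =>
        mul_nonneg net.w0_nonneg (layerProd_nonneg net.W_nonneg _ _ _ _)
    refine Real.sqrt_le_iff.2 ⟨by positivity, ?_⟩
    nlinarith [sq_nonneg (net.Vout ℓ - net.Vin ℓ)]
  have hbar : √net.Vtot ≤ net.Vbar := by
    have h := Finset.sum_le_sum hterm
    rw [Finset.sum_const, Finset.card_range, nsmul_eq_mul] at h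
    rw [RampNet.Vbar, one_div, inv_mul_eq_div, le_div_iff₀ hLR]
    linarith
  calc net.Vtot = √net.Vtot * √net.Vtot := (Real.mul_self_sqrt hV).symm
    _ ≤ _ := mul_le_mul_of_nonneg_right hbar (Real.sqrt_nonneg _)

/-- The partition into level sets of a monotone labelling of `Fin M` is determined by `M` bits,
marking the first element of each level set. -/
lemma exists_breakpoints {M : ℕ} {f : Fin M → ℕ} (hf : Monotone f) : ∃ b : Fin M → Bool,
    ∀ m m', (Finset.univ.filter fun i => i ≤ m ∧ b i).card =
      (Finset.univ.filter fun i => i ≤ m' ∧ b i).card ↔ f m = f m' := by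
  classical
  let b : Fin M → Bool := fun i => decide (∀ i' < i, f i' ≠ f i)
  have key : ∀ m m', m ≤ m' → ((Finset.univ.filter fun i => i ≤ m ∧ b i).card =
      (Finset.univ.filter fun i => i ≤ m' ∧ b i).card ↔ f m = f m') := by
    intro m m' hmm
    constructor
    · intro hcard
      by_contra hne
      have hex : ∃ i, f i = f m' := ⟨m', rfl⟩
      have hne' : (Finset.univ.filter fun i => f i = f m').Nonempty := ⟨m', by simp⟩
      set i₀ := (Finset.univ.filter fun i => f i = f m').min' hne' with hi₀
      have hi₀f : f i₀ = f m' := by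
        have := Finset.min'_mem _ hne'
        simpa using this
      have hi₀le : i₀ ≤ m' := Finset.min'_le _ _ (by simp)
      have hbi₀ : b i₀ = true := by
        simp only [b, decide_eq_true_eq]
        intro i' hi' heq
        exact absurd (Finset.min'_le (Finset.univ.filter fun i => f i = f m') i'
          (by simp [heq, hi₀f])) (not_le.2 hi')
      have hmi : m < i₀ := by
        by_contra hle
        have h1 := hf (not_lt.1 hle)
        exact hne (le_antisymm (hf hmm) (hi₀f ▸ h1))
      refine hcard.not_lt (Finset.card_lt_card ?_)
      rw [Finset.ssubset_iff_of_subset]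
      · exact ⟨i₀, by simp [hi₀le, hbi₀], by simp [hmi]⟩
      · intro i hi
        simp only [Finset.mem_filter, Finset.mem_univ, true_and] at hi ⊢
        exact ⟨hi.1.trans hmm, hi.2⟩
    · intro heq
      congr 1
      ext i
      simp only [Finset.mem_filter, Finset.mem_univ, true_and]
      refine ⟨fun h => ⟨h.1.trans hmm, h.2⟩, fun h => ⟨?_, h.2⟩⟩
      by_contra hi
      have hb : ∀ i' < i, f i' ≠ f i := by simpa [b] using h.2
      exact hb m (not_le.1 hi) (le_antisymm (hf (not_le.1 hi).le) (heq ▸ hf h.1))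
  refine ⟨b, fun m m' => ?_⟩
  rcases le_total m m' with h | h
  · exact key m m' h
  · rw [eq_comm, key m' m h, eq_comm]

/-- Finite descriptions of empirical networks with `K + 1` hidden layers and `M` paths: signs,
labels in `Fin (A k)` for the layers `k < K`, breakpoints for the last layer, inputs, and a grid
point for the variation. -/
abbrev EmpCode (K d_in M : ℕ) (A : ℕ → ℕ) : Type :=
  (Fin (K + 1) → Fin M → Bool) × ((k : Fin K) → Fin M → Fin (A k)) × (Fin M → Bool) ×
    (Fin M → Fin (2 * d_in)) × Fin (M + 1)

variable {K d_in M : ℕ} {A : ℕ → ℕ}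

/-- The path labels described by a code. -/
def codeCls (l : (k : Fin K) → Fin M → Fin (A k)) (b : Fin M → Bool) (k : ℕ) (m : Fin M) : ℕ :=
  if h : k < K then l ⟨k, h⟩ m else (Finset.univ.filter fun i => i ≤ m ∧ b i).card

/-- The unit signs described by a code. -/
def codeSign (s : Fin (K + 1) → Fin M → Bool) (k : ℕ) (m : Fin M) : Bool :=
  if h : k < K + 1 then s ⟨k, h⟩ m else true

/-- The unscaled empirical network described by a code. -/
def codeOut (c : EmpCode K d_in M A) : (ℕ → ℝ) → ℝ :=
  empOut d_in (codeCls c.2.1 c.2.2.1) (codeSign c.1) (fun m => c.2.2.2.1 m) (K + 1)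

/-- Truncation of a real number to `[-B, B]`. -/
def clip (B t : ℝ) : ℝ := max (-B) (min B t)

lemma abs_clip_le {B : ℝ} (hB : 0 ≤ B) (t : ℝ) : |clip B t| ≤ B :=
  abs_le.2 ⟨le_max_left _ _, max_le (by linarith) (min_le_left _ _)⟩

lemma clip_eq_self {B t : ℝ} (ht : |t| ≤ B) : clip B t = t := by
  rw [abs_le] at ht
  rw [clip, min_eq_right ht.2, max_eq_right ht.1]

lemma abs_clip_sub_clip_le (B s t : ℝ) : |clip B s - clip B t| ≤ |s - t| := by
  refine (abs_max_sub_max_le_max _ _ _ _).trans (max_le (by simp) ?_)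
  exact (abs_min_sub_min_le_max _ _ _ _).trans (max_le (by simp) le_rfl)

/-- The candidate function described by a code, with variation on a grid of `[0, v]`. -/
def candidate (B v : ℝ) (c : EmpCode K d_in M A) (x : ℕ → ℝ) : ℝ :=
  clip B (v * (c.2.2.2.2 : ℕ) / M * codeOut c x)

lemma measurable_candidate (B v : ℝ) (c : EmpCode K d_in M A) :
    Measurable (candidate B v c) := by
  have := measurable_empOut (d_in := d_in) (codeCls c.2.1 c.2.2.1) (codeSign c.1)
    (fun m => c.2.2.2.1 m) (K + 1)
  unfold candidate clip codeOut
  fun_prop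

/-- Every empirical network of sampled paths is described by a code. -/
lemma exists_code_eq {d : ℕ → ℕ} (hdL : d (K + 2) = 2 * d_in) {Y : ℕ → Fin M → ℕ}
    (hY : ∀ ℓ ≤ K + 2, ∀ m, Y ℓ m < d ℓ)
    (hA : ∀ k < K, ∀ c : Fin M → ℕ, (∀ m, c m < d (K + 2 - (k + 1))) →
      ∃ c' : Fin M → Fin (A k), ∀ m m', c' m = c' m' ↔ c m = c m') (i : Fin (M + 1)) :
    ∃ c : EmpCode K d_in M A, c.2.2.2.2 = i ∧
      codeOut c = empOut d_in (pathCls (K + 2) Y) (pathSign (K + 2) d Y) (Y (K + 2)) (K + 1) := by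
  let σ := Tuple.sort (Y 1)
  obtain ⟨b, hb⟩ := exists_breakpoints (Tuple.monotone_sort (Y 1))
  choose l hl using fun k : Fin K => hA k k.2 (fun m => Y (K + 2 - (k + 1)) (σ m))
    fun m => hY _ (by omega) _
  refine ⟨(fun k m => pathSign (K + 2) d Y k (σ m), l, b,
    fun m => ⟨Y (K + 2) (σ m), hdL ▸ hY _ le_rfl _⟩, i), rfl, ?_⟩
  funext x
  refine empOut_congr σ x (fun k hk m m' => ?_) (fun k hk m => ?_) fun m => rfl
  · unfold codeCls pathCls
    by_cases h : k < K
    · simp only [h, dif_pos]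
      rw [← hl ⟨k, h⟩ m m', Fin.ext_iff]
    · obtain rfl : k = K := by omega
      simp only [h, dif_neg, not_false_iff]
      rw [show k + 2 - (k + 1) = 1 by omega]
      exact hb m m'
  · simp [codeSign, hk]

lemma log_card_empCode_le (hA : ∀ k, 0 < A k) (hd : 0 < d_in) :
    Real.log (Fintype.card (EmpCode K d_in M A)) ≤
      M * (∑ k ∈ Finset.range K, Real.log (2 * A k) + Real.log (16 * d_in)) := by
  have hdR : (0 : ℝ) < d_in := by exact_mod_cast hd
  have hAR : ∀ k, (0 : ℝ) < A k := fun k => by exact_mod_cast hA k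
  have hgrid : ((M + 1 : ℕ) : ℝ) ≤ 2 ^ M := by exact_mod_cast Nat.lt_two_pow_self
  have hcard : (Fintype.card (EmpCode K d_in M A) : ℝ) ≤
      ((∏ k ∈ Finset.range K, (2 * A k : ℝ)) * (16 * d_in)) ^ M := by
    simp only [EmpCode, Fintype.card_prod, Fintype.card_pi, Fintype.card_bool, Fintype.card_fin,
      Finset.prod_const, Finset.card_univ, Nat.cast_mul, Nat.cast_pow, Nat.cast_prod]
    rw [← Finset.prod_range fun k => ((A k : ℝ) ^ M), Finset.prod_pow, Finset.prod_mul_distrib,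
      Finset.prod_const, Finset.card_range]
    calc _ ≤ (((2 : ℕ) : ℝ) ^ M) ^ (K + 1) * ((∏ k ∈ Finset.range K, (A k : ℝ)) ^ M *
          (((2 : ℕ) : ℝ) ^ M * ((((2 : ℕ) : ℝ) * d_in) ^ M * 2 ^ M))) := by
          gcongr
      _ = _ := by
          rw [show (16 : ℝ) = 2 * 2 * 2 * 2 by norm_num]
          push_cast
          simp only [mul_pow, ← pow_mul]
          ring
  have hpos : (0 : ℝ) < Fintype.card (EmpCode K d_in M A) := by
    have : ∀ k : Fin K, Nonempty (Fin (A k)) := fun k => ⟨⟨0, hA k⟩⟩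
    have : Nonempty (Fin (2 * d_in)) := ⟨⟨0, by omega⟩⟩
    exact_mod_cast Fintype.card_pos
  refine (Real.log_le_log hpos hcard).trans (le_of_eq ?_)
  rw [Real.log_pow, Real.log_mul (Finset.prod_pos fun k _ => by have := hAR k; positivity).ne'
    (by positivity), Real.log_prod fun k _ => by have := hAR k; positivity]

lemma exists_candidate_approx {d : ℕ → ℕ} (net : RampNet (K + 2) d_in d) (hd : d 0 = 1)
    (hdL : d (K + 2) = 2 * d_in) (hpos : ∀ ℓ ≤ K + 2, 0 < d ℓ) {v : ℝ} (hv : 0 < v)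
    (hnet : net.compVar ≤ v) {B : ℝ} (hM : 0 < M) (P_X : Measure (ℕ → ℝ))
    [IsProbabilityMeasure P_X] (hcube : ∀ᵐ x ∂P_X, ∀ i < d_in, |x i| ≤ 1)
    (hA : ∀ k < K, ∀ c : Fin M → ℕ, (∀ m, c m < d (K + 2 - (k + 1))) →
      ∃ c' : Fin M → Fin (A k), ∀ m m', c' m = c' m' ↔ c m = c m') :
    ∃ c : EmpCode K d_in M A, ∫ x, (clip B (net.eval x) - candidate B v c x) ^ 2 ∂P_X ≤
      10 * (((K + 2 : ℕ) : ℝ) * v) ^ 2 / M := by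
  have hMR : (1 : ℝ) ≤ M := by exact_mod_cast hM
  have hM0 : (0 : ℝ) < M := by linarith
  obtain ⟨Y, hY, hYerr⟩ := exists_empOut_approx net hd hdL hpos (by omega) hM P_X hcube
  have hV0 := Vtot_nonneg net hd
  have hVv : net.Vtot ≤ v := (Vtot_le_compVar net hd (by omega)).trans hnet
  have hcv : 0 ≤ net.compVar := hV0.trans (Vtot_le_compVar net hd (by omega))
  set V := net.Vtot with hV
  set i := ⌊V * M / v⌋₊ with hi
  have hiM : i < M + 1 := by
    refine Nat.lt_succ_of_le (Nat.floor_le_of_le ?_)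
    rw [div_le_iff₀ hv, mul_comm]
    gcongr
  obtain ⟨c, hci, hc⟩ := exists_code_eq hdL hY hA ⟨i, hiM⟩
  rw [show K + 1 = K + 2 - 1 by omega] at hc
  set E := empOut d_in (pathCls (K + 2) Y) (pathSign (K + 2) d Y) (Y (K + 2)) (K + 2 - 1) with hE
  have hEmeas : Measurable E := measurable_empOut _ _ _ _
  have hfmeas := measurable_eval net
  refine ⟨c, ?_⟩
  have hgrid : |V - v * i / M| ≤ v / M := by
    have h1 : (i : ℝ) ≤ V * M / v := Nat.floor_le (by positivity)
    have h2 : V * M / v < i + 1 := Nat.lt_floor_add_one _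
    rw [le_div_iff₀ hv] at h1
    rw [div_lt_iff₀ hv] at h2
    have e : V - v * i / M = (V * M - i * v) / M := by field_simp
    rw [e, abs_div, abs_of_pos hM0, abs_of_nonneg (by linarith)]
    gcongr
    linarith
  have hEone : ∀ x : ℕ → ℝ, (∀ i < d_in, |x i| ≤ 1) → |E x| ≤ 1 := fun x hx =>
    abs_empOut_le_one _ _ (fun m => hdL ▸ hY _ le_rfl m) hx _
  have hintegr : Integrable (fun x => (net.eval x - V * E x) ^ 2) P_X := by
    refine Integrable.of_bound (C := (V + V * 1) ^ 2) (by
      apply Measurable.aestronglyMeasurable; fun_prop) ?_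
    filter_upwards [hcube] with x hx
    rw [Real.norm_eq_abs, abs_pow]
    refine pow_le_pow_left₀ (abs_nonneg _) ((abs_sub _ _).trans ?_) 2
    rw [abs_mul, abs_of_nonneg hV0]
    have := hEone x hx
    have := abs_eval_le_Vtot net hd hdL hpos (by omega) hx
    gcongr
  have hbound : ∀ x : ℕ → ℝ, (∀ i < d_in, |x i| ≤ 1) →
      (clip B (net.eval x) - candidate B v c x) ^ 2 ≤
        2 * (net.eval x - V * E x) ^ 2 + 2 * (v / M) ^ 2 := by
    intro x hx
    have h1 : |clip B (net.eval x) - candidate B v c x| ≤ |net.eval x - v * i / M * E x| := by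
      unfold candidate
      rw [hc, hci]
      exact abs_clip_sub_clip_le _ _ _
    have h2 : |(V - v * i / M) * E x| ≤ v / M := by
      rw [abs_mul, ← mul_one (v / M)]
      exact mul_le_mul hgrid (hEone x hx) (abs_nonneg _) (by positivity)
    have h3 := sq_le_sq.2 h1
    have h4 : ((V - v * i / M) * E x) ^ 2 ≤ (v / M) ^ 2 := by
      rw [← sq_abs]
      exact pow_le_pow_left₀ (abs_nonneg _) h2 2
    nlinarith [sq_nonneg ((net.eval x - V * E x) - (V - v * i / M) * E x)]
  have hcmeas := measurable_candidate B v c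
  calc ∫ x, (clip B (net.eval x) - candidate B v c x) ^ 2 ∂P_X
      ≤ ∫ x, (2 * (net.eval x - V * E x) ^ 2 + 2 * (v / M) ^ 2) ∂P_X := by
        refine integral_mono_of_nonneg (Filter.Eventually.of_forall fun x => sq_nonneg _)
          ((hintegr.const_mul 2).add (integrable_const _)) ?_
        filter_upwards [hcube] with x hx using hbound x hx
    _ = 2 * ∫ x, (net.eval x - V * E x) ^ 2 ∂P_X + 2 * (v / M) ^ 2 := by
        rw [integral_add (hintegr.const_mul 2) (integrable_const _), integral_const_mul]
        simp
    _ ≤ 2 * ((2 * (((K + 2 : ℕ) : ℝ) * v)) ^ 2 / M) + 2 * ((((K + 2 : ℕ) : ℝ) * v) ^ 2 / M) := by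
        have hK : (1 : ℝ) ≤ ((K + 2 : ℕ) : ℝ) := by exact_mod_cast (by omega : 1 ≤ K + 2)
        have hKv : v ≤ ((K + 2 : ℕ) : ℝ) * v := le_mul_of_one_le_left hv.le hK
        have hsq : (v / M) ^ 2 ≤ (((K + 2 : ℕ) : ℝ) * v) ^ 2 / M := by
          rw [div_pow]
          gcongr
          nlinarith
        have := hYerr.trans (b := _) (c := (2 * (((K + 2 : ℕ) : ℝ) * v)) ^ 2 / M) (by gcongr)
        linarith
    _ = _ := by ring

end Encoding

/-! ### Risk bounds -/

section Risk

lemma regLaw_congr_ae {P_X : Measure (ℕ → ℝ)} [IsProbabilityMeasure P_X] {f f' : (ℕ → ℝ) → ℝ}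
    (h : f =ᵐ[P_X] f') (σ2 : NNReal) :
    regLaw P_X f σ2 = regLaw P_X f' σ2 := by
  unfold regLaw
  refine Measure.map_congr ?_
  have := Measure.quasiMeasurePreserving_fst (μ := P_X) (ν := gaussianReal 0 σ2) |>.ae h
  filter_upwards [this] with p hp
  rw [hp]

/-- Risk bound for least squares over empirical networks with `M` paths. -/
lemma exists_estimator {K d_in M n : ℕ} {A d : ℕ → ℕ} (hd : d 0 = 1)
    (hdL : d (K + 2) = 2 * d_in) (hpos : ∀ ℓ ≤ K + 2, 0 < d ℓ) {v : ℝ} (hv : 0 < v)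
    {B : ℝ} (hB : 0 < B) {σ2 : NNReal} (hσ2 : 0 < σ2) (hn : 1 ≤ n) (hM : 0 < M)
    (P_X : Measure (ℕ → ℝ)) [IsProbabilityMeasure P_X]
    (hcube : ∀ᵐ x ∂P_X, ∀ i < d_in, |x i| ≤ 1) (hA0 : ∀ k, 0 < A k)
    (hA : ∀ k < K, ∀ c : Fin M → ℕ, (∀ m, c m < d (K + 2 - (k + 1))) →
      ∃ c' : Fin M → Fin (A k), ∀ m m', c' m = c' m' ↔ c m = c m') :
    ∃ Fhat : (Fin n → (ℕ → ℝ) × ℝ) → (ℕ → ℝ) → ℝ, Measurable (Function.uncurry Fhat) ∧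
      ∀ f ∈ FLv (K + 2) d_in d v, (∀ x : ℕ → ℝ, (∀ i < d_in, |x i| ≤ 1) → |f x| ≤ B) →
        (∫ D, (∫ x, (f x - Fhat D x) ^ 2 ∂P_X)
            ∂(Measure.pi fun _ : Fin n => regLaw P_X f σ2)) ≤
          (expRate B σ2)⁻¹ *
            (M * (∑ k ∈ Finset.range K, Real.log (2 * A k) + Real.log (16 * d_in)) / n +
              1 / (4 * (σ2 : ℝ)) * (10 * (((K + 2 : ℕ) : ℝ) * v) ^ 2 / M)) := by
  have hdin : 0 < d_in := by have := hpos _ le_rfl; omega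
  have : ∀ k : Fin K, Nonempty (Fin (A k)) := fun k => ⟨⟨0, hA0 k⟩⟩
  have : Nonempty (Fin (2 * d_in)) := ⟨⟨0, by omega⟩⟩
  obtain ⟨Fhat, hmeas, hrisk⟩ := exists_leastSquares_estimator (P_X := P_X) hσ2 hn
    (fun c : EmpCode K d_in M A => candidate B v c) (measurable_candidate B v)
    fun c x => abs_clip_le hB.le _
  refine ⟨Fhat, hmeas, ?_⟩
  rintro f ⟨net, hnet, hf⟩ hfB
  obtain rfl : f = net.eval := funext hf
  have hmf := measurable_eval net
  have hmf' : Measurable fun x => clip B (net.eval x) := by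
    unfold clip
    fun_prop
  have hae : net.eval =ᵐ[P_X] fun x => clip B (net.eval x) := by
    filter_upwards [hcube] with x hx using (clip_eq_self (hfB x hx)).symm
  obtain ⟨c, hc⟩ := exists_candidate_approx (A := A) net hd hdL hpos hv hnet hM P_X hcube hA
  have hr := hrisk _ hmf' (fun x => abs_clip_le hB.le _) c
  rw [regLaw_congr_ae hae]
  have hinner : ∀ D, ∫ x, (net.eval x - Fhat D x) ^ 2 ∂P_X =
      ∫ x, (clip B (net.eval x) - Fhat D x) ^ 2 ∂P_X := fun D => by
    refine integral_congr_ae ?_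
    filter_upwards [hae] with x hx
    rw [← hx]
  simp only [hinner]
  refine hr.trans ?_
  have := expRate_pos (B := B) hσ2
  have hlog := log_card_empCode_le (M := M) (K := K) hA0 hdin
  gcongr

/-- Risk bound for the zero estimator. -/
lemma integral_sq_sub_zero_le {L d_in n : ℕ} {d : ℕ → ℕ} (hL : 1 ≤ L) (hd : d 0 = 1)
    (hdL : d L = 2 * d_in) (hpos : ∀ ℓ ≤ L, 0 < d ℓ) {v : ℝ}
    {σ2 : NNReal} (P_X : Measure (ℕ → ℝ)) [IsProbabilityMeasure P_X]
    (hcube : ∀ᵐ x ∂P_X, ∀ i < d_in, |x i| ≤ 1) {f : (ℕ → ℝ) → ℝ} (hf : f ∈ FLv L d_in d v) :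
    (∫ _D, (∫ x, (f x - 0) ^ 2 ∂P_X) ∂(Measure.pi fun _ : Fin n => regLaw P_X f σ2)) ≤
      v ^ 2 := by
  obtain ⟨net, hnet, hfe⟩ := hf
  obtain rfl : f = net.eval := funext hfe
  have hmf := measurable_eval net
  have : IsProbabilityMeasure (regLaw P_X net.eval σ2) :=
    Measure.isProbabilityMeasure_map (by fun_prop)
  rw [integral_const, probReal_univ, one_smul]
  calc ∫ x, (net.eval x - 0) ^ 2 ∂P_X ≤ ∫ _x, v ^ 2 ∂P_X := by
        refine integral_mono_of_nonneg (Filter.Eventually.of_forall fun x => sq_nonneg _)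
          (integrable_const _) ?_
        filter_upwards [hcube] with x hx
        rw [sub_zero, ← sq_abs]
        exact pow_le_pow_left₀ (abs_nonneg _) ((abs_eval_le_Vtot net hd hdL hpos hL hx).trans
          ((Vtot_le_compVar net hd hL).trans hnet)) 2
    _ = v ^ 2 := by simp

lemma exists_estimator_of_entropy_le {K d_in n : ℕ} {d : ℕ → ℕ} (hd : d 0 = 1)
    (hdL : d (K + 2) = 2 * d_in) (hpos : ∀ ℓ ≤ K + 2, 0 < d ℓ) {v : ℝ} (hv : 0 < v)
    {B : ℝ} (hB : 0 < B) {σ2 : NNReal} (hσ2 : 0 < σ2) (hn : 1 ≤ n)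
    (P_X : Measure (ℕ → ℝ)) [IsProbabilityMeasure P_X]
    (hcube : ∀ᵐ x ∂P_X, ∀ i < d_in, |x i| ≤ 1) {H : ℝ} (hH : 0 < H)
    (h : v ^ 2 ≤ ((K + 2 : ℕ) : ℝ) * v * √(H / n) ∨
      ∀ M : ℕ, 0 < M → (M : ℝ) ≤ 2 * (((K + 2 : ℕ) : ℝ) * v / √(H / n)) →
        ∃ A : ℕ → ℕ, (∀ k, 0 < A k) ∧
          (∀ k < K, ∀ c : Fin M → ℕ, (∀ m, c m < d (K + 2 - (k + 1))) →
            ∃ c' : Fin M → Fin (A k), ∀ m m', c' m = c' m' ↔ c m = c m') ∧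
          ∑ k ∈ Finset.range K, Real.log (2 * A k) + Real.log (16 * d_in) ≤ 4 * H) :
    ∃ Fhat : (Fin n → (ℕ → ℝ) × ℝ) → (ℕ → ℝ) → ℝ, Measurable (Function.uncurry Fhat) ∧
      ∀ f ∈ FLv (K + 2) d_in d v, (∀ x : ℕ → ℝ, (∀ i < d_in, |x i| ≤ 1) → |f x| ≤ B) →
        (∫ D, (∫ x, (f x - Fhat D x) ^ 2 ∂P_X)
            ∂(Measure.pi fun _ : Fin n => regLaw P_X f σ2)) ≤
          (1 + (expRate B σ2)⁻¹ * (8 + 10 / (4 * (σ2 : ℝ)))) * ((K + 2 : ℕ) : ℝ) * v *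
            √(H / n) := by
  have hnR : (0 : ℝ) < n := by exact_mod_cast hn
  have hσR : (0 : ℝ) < σ2 := hσ2
  have hr := inv_pos.2 (expRate_pos (B := B) hσ2)
  have hL : (1 : ℝ) ≤ ((K + 2 : ℕ) : ℝ) := by exact_mod_cast (by omega : 1 ≤ K + 2)
  set q := √(H / n) with hq
  have hq0 : 0 < q := Real.sqrt_pos.2 (by positivity)
  have hq2 : q ^ 2 = H / n := Real.sq_sqrt (by positivity)
  set s := ((K + 2 : ℕ) : ℝ) * v * q with hs
  have hs0 : 0 < s := by positivity
  have hσ' : (0 : ℝ) ≤ (expRate B σ2)⁻¹ * (8 + 10 / (4 * (σ2 : ℝ))) := by positivity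
  have hrhs : (1 + (expRate B σ2)⁻¹ * (8 + 10 / (4 * (σ2 : ℝ)))) * ((K + 2 : ℕ) : ℝ) * v * q =
      s + (expRate B σ2)⁻¹ * (8 * s + 1 / (4 * (σ2 : ℝ)) * (10 * s)) := by
    rw [hs]
    ring
  rw [hrhs]
  set t := ((K + 2 : ℕ) : ℝ) * v / q with ht
  have ht0 : 0 < t := by positivity
  have hzero : v ^ 2 ≤ s → ∃ Fhat : (Fin n → (ℕ → ℝ) × ℝ) → (ℕ → ℝ) → ℝ,
      Measurable (Function.uncurry Fhat) ∧ ∀ f ∈ FLv (K + 2) d_in d v,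
        (∀ x : ℕ → ℝ, (∀ i < d_in, |x i| ≤ 1) → |f x| ≤ B) →
        (∫ D, (∫ x, (f x - Fhat D x) ^ 2 ∂P_X)
            ∂(Measure.pi fun _ : Fin n => regLaw P_X f σ2)) ≤
          s + (expRate B σ2)⁻¹ * (8 * s + 1 / (4 * (σ2 : ℝ)) * (10 * s)) := by
    refine fun hvs => ⟨fun _ _ => 0, measurable_const, fun f hf _ => ?_⟩
    refine (integral_sq_sub_zero_le (by omega) hd hdL hpos P_X hcube hf).trans (hvs.trans ?_)
    exact le_add_of_nonneg_right (by positivity)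
  rcases h with h | h
  · exact hzero h
  rcases le_or_gt t 1 with ht1 | ht1
  · refine hzero ?_
    rw [ht, div_le_one hq0] at ht1
    have hv1 : v ≤ ((K + 2 : ℕ) : ℝ) * v := le_mul_of_one_le_left hv.le hL
    rw [hs, pow_two]
    exact mul_le_mul hv1 (hv1.trans ht1) hv.le (by positivity)
  · have hMt : t ≤ ⌈t⌉₊ := Nat.le_ceil t
    have hMt2 : (⌈t⌉₊ : ℝ) ≤ 2 * t := by
      have := Nat.ceil_lt_add_one ht0.le
      linarith
    have hM : 0 < ⌈t⌉₊ := Nat.ceil_pos.2 ht0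
    generalize ⌈t⌉₊ = M at *
    have hMR : (0 : ℝ) < M := by exact_mod_cast hM
    obtain ⟨A, hA0, hA, hsum⟩ := h M hM hMt2
    obtain ⟨Fhat, hmeas, hrisk⟩ := exists_estimator (n := n) hd hdL hpos hv hB hσ2 hn hM P_X hcube
      hA0 hA
    refine ⟨Fhat, hmeas, fun f hf hfB => (hrisk f hf hfB).trans ?_⟩
    have hq2t : t * q = ((K + 2 : ℕ) : ℝ) * v := by rw [ht]; field_simp
    have h1 : M * (∑ k ∈ Finset.range K, Real.log (2 * A k) + Real.log (16 * d_in)) / n ≤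
        8 * s := by
      calc M * (∑ k ∈ Finset.range K, Real.log (2 * A k) + Real.log (16 * d_in)) / n
          ≤ M * (4 * H) / n := by gcongr
        _ ≤ 2 * t * (4 * H) / n := by gcongr
        _ = 8 * t * (H / n) := by ring
        _ = 8 * (t * q * q) := by rw [← hq2]; ring
        _ = 8 * s := by rw [hq2t]
    have h2 : 10 * (((K + 2 : ℕ) : ℝ) * v) ^ 2 / M ≤ 10 * s := by
      rw [div_le_iff₀ hMR, ← hq2t, hs, ← hq2t]
      have : 0 ≤ 10 * (t * q * q) * t * (M / t - 1) := by
        refine mul_nonneg (by positivity) ?_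
        rw [sub_nonneg, le_div_iff₀ ht0]
        linarith
      have e : 10 * (t * q * q) * t * (M / t - 1) = 10 * (t * q * q) * M - 10 * (t * q) ^ 2 := by
        field_simp
      linarith
    calc _ ≤ (expRate B σ2)⁻¹ * (8 * s + 1 / (4 * (σ2 : ℝ)) * (10 * s)) := by gcongr
      _ ≤ _ := le_add_of_nonneg_left hs0.le

lemma sum_log_eq_mul_log_dbar {K : ℕ} {d : ℕ → ℕ} (hpos : ∀ ℓ ≤ K + 2, 0 < d ℓ) :
    ∑ k ∈ Finset.range K, Real.log (d (K + 2 - (k + 1))) = K * Real.log (dbar (K + 2) d) := by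
  have hprod : ∏ ℓ ∈ Finset.Icc 2 (K + 2 - 1), (d ℓ : ℝ) =
      ∏ k ∈ Finset.range K, (d (K + 2 - (k + 1)) : ℝ) := by
    rw [← Finset.prod_range_reflect]
    have : Finset.Icc 2 (K + 2 - 1) = Finset.Ico 2 (K + 2) := by
      ext i
      simp only [Finset.mem_Icc, Finset.mem_Ico]
      omega
    rw [this, Finset.prod_Ico_eq_prod_range]
    refine Finset.prod_congr rfl fun i hi => ?_
    rw [Finset.mem_range] at hi
    congr 2
    omega
  have hne : ∀ k ∈ Finset.range K, (d (K + 2 - (k + 1)) : ℝ) ≠ 0 := fun k _ =>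
    Nat.cast_ne_zero.2 (hpos _ (by omega)).ne'
  rw [dbar, hprod, Real.log_rpow (Finset.prod_pos fun k _ => Nat.cast_pos.2 (hpos _ (by omega))),
    Real.log_prod hne]
  rcases Nat.eq_zero_or_pos K with rfl | hK
  · simp
  · have : (K : ℝ) ≠ 0 := by positivity
    push_cast
    rw [show (K : ℝ) + 2 - 2 = K by ring, mul_inv_cancel_left₀ this]

end Risk

/-- There is a constant `C > 0` depending only on `B` and `σ²` such
that for every `n ≥ 1`, `v > 0` and probability measure `P_X` on `[−1,1]^{d_in}`, the
minimax risk over `G_{L,v}` (functions of `F_{L,v}` bounded by `B` on the cube) is at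
most `C·L·v·√(((L−2)·log d̄ + log(8e·d_in))/n)`; moreover, provided `v·√n ≥ e`, the
dimension-free bound with `log(v√n)` in place of `log d̄` also holds.  (The minimax
bounds are expressed by exhibiting estimators with the corresponding uniform risk
guarantees.) -/
theorem statement16 (B : ℝ) (hB : 0 < B) (σ2 : NNReal) (hσ2 : 0 < σ2) :
    ∃ C : ℝ, 0 < C ∧
      ∀ (L d_in : ℕ), 2 ≤ L → 1 ≤ d_in →
      ∀ d : ℕ → ℕ, d 0 = 1 → d L = 2 * d_in →
        (∀ ℓ, 0 < ℓ → ℓ < L → Even (d ℓ) ∧ 2 ≤ d ℓ) →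
      ∀ n : ℕ, 1 ≤ n →
      ∀ v : ℝ, 0 < v →
      ∀ P_X : Measure (ℕ → ℝ), IsProbabilityMeasure P_X →
        (∀ᵐ x ∂P_X, ∀ i < d_in, |x i| ≤ 1) →
        (∃ Fhat : (Fin n → (ℕ → ℝ) × ℝ) → (ℕ → ℝ) → ℝ,
          Measurable (Function.uncurry Fhat) ∧
          ∀ f : (ℕ → ℝ) → ℝ, f ∈ FLv L d_in d v →
            (∀ x : ℕ → ℝ, (∀ i < d_in, |x i| ≤ 1) → |f x| ≤ B) →
            (∫ D, (∫ x, (f x - Fhat D x) ^ 2 ∂P_X)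
                ∂(Measure.pi fun _ : Fin n => regLaw P_X f σ2)) ≤
              C * L * v * Real.sqrt
                ((((L : ℝ) - 2) * Real.log (dbar L d) +
                  Real.log (8 * Real.exp 1 * d_in)) / n)) ∧
        (v * Real.sqrt n ≥ Real.exp 1 →
          ∃ Fhat : (Fin n → (ℕ → ℝ) × ℝ) → (ℕ → ℝ) → ℝ,
            Measurable (Function.uncurry Fhat) ∧
            ∀ f : (ℕ → ℝ) → ℝ, f ∈ FLv L d_in d v →
              (∀ x : ℕ → ℝ, (∀ i < d_in, |x i| ≤ 1) → |f x| ≤ B) →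
              (∫ D, (∫ x, (f x - Fhat D x) ^ 2 ∂P_X)
                  ∂(Measure.pi fun _ : Fin n => regLaw P_X f σ2)) ≤
                C * L * v * Real.sqrt
                  ((((L : ℝ) - 2) * Real.log (v * Real.sqrt n) +
                    Real.log (8 * Real.exp 1 * d_in)) / n)) := by
  have hr := inv_pos.2 (expRate_pos (B := B) hσ2)
  have hσR : (0 : ℝ) < σ2 := hσ2
  refine ⟨1 + (expRate B σ2)⁻¹ * (8 + 10 / (4 * (σ2 : ℝ))), by positivity, ?_⟩
  intro L d_in hL hdin d hd hdL hwidth n hn v hv P_X hP hcube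
  obtain ⟨K, rfl⟩ : ∃ K, L = K + 2 := ⟨L - 2, by omega⟩
  have hpos : ∀ ℓ ≤ K + 2, 0 < d ℓ := by
    intro ℓ hℓ
    rcases Nat.eq_zero_or_pos ℓ with rfl | h0
    · omega
    rcases hℓ.lt_or_eq with h1 | rfl
    · have := (hwidth ℓ h0 h1).2
      omega
    · omega
  have hdinR : (1 : ℝ) ≤ d_in := by exact_mod_cast hdin
  have hnR : (0 : ℝ) < n := by exact_mod_cast hn
  have he1 : (2 : ℝ) ≤ Real.exp 1 := by linarith [Real.add_one_le_exp (1 : ℝ)]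
  have hlog1 : 1 ≤ Real.log (8 * Real.exp 1 * d_in) := by
    rw [Real.le_log_iff_exp_le (by positivity)]
    nlinarith [Real.exp_pos 1]
  have hlog16 : Real.log (16 * d_in) ≤ Real.log (8 * Real.exp 1 * d_in) := by
    refine Real.log_le_log (by positivity) ?_
    gcongr
    linarith
  have hK2 : ((K + 2 : ℕ) : ℝ) - 2 = K := by push_cast; ring
  rw [hK2]
  constructor
  · rw [← sum_log_eq_mul_log_dbar hpos]
    have hlogd : ∀ k ∈ Finset.range K, Real.log (2 * d (K + 2 - (k + 1))) ≤
        2 * Real.log (d (K + 2 - (k + 1))) := by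
      intro k hk
      rw [Finset.mem_range] at hk
      have h2 : (2 : ℝ) ≤ d (K + 2 - (k + 1)) := by
        exact_mod_cast (hwidth (K + 2 - (k + 1)) (by omega) (by omega)).2
      rw [Real.log_mul (by norm_num) (by positivity)]
      linarith [Real.log_le_log (by norm_num) h2]
    have hS : 0 ≤ ∑ k ∈ Finset.range K, Real.log (d (K + 2 - (k + 1))) :=
      Finset.sum_nonneg fun k _ => Real.log_natCast_nonneg _
    refine exists_estimator_of_entropy_le hd hdL hpos hv hB hσ2 hn P_X hcube (by positivity)
      (Or.inr fun M hM _ => ⟨fun k => d (K + 2 - (k + 1)), fun k => hpos _ (by omega),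
        fun k _ c hc => ⟨fun m => ⟨c m, hc m⟩, fun m m' => by simp⟩, ?_⟩)
    have := Finset.sum_le_sum hlogd
    rw [← Finset.mul_sum] at this
    linarith
  · intro ha
    set a := v * √n with ha_def
    have ha0 : 0 < a := by positivity
    have hloga : 1 ≤ Real.log a := (Real.le_log_iff_exp_le ha0).2 ha
    have hH1 : 1 ≤ K * Real.log a + Real.log (8 * Real.exp 1 * d_in) := by
      have : 0 ≤ K * Real.log a := by positivity
      linarith
    refine exists_estimator_of_entropy_le hd hdL hpos hv hB hσ2 hn P_X hcube (by linarith) ?_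
    set H := K * Real.log a + Real.log (8 * Real.exp 1 * d_in) with hH
    have hsqH : 1 ≤ √H := Real.one_le_sqrt.2 hH1
    have hsn : 0 < √(n : ℝ) := Real.sqrt_pos.2 hnR
    have hL0 : (0 : ℝ) < ((K + 2 : ℕ) : ℝ) := by positivity
    rw [Real.sqrt_div (by linarith)]
    rcases le_or_gt a ((K + 2 : ℕ) : ℝ) with haL | haL
    · left
      have : v ≤ ((K + 2 : ℕ) : ℝ) * (√H / √n) := by
        rw [← mul_div_assoc, le_div_iff₀ hsn]
        nlinarith
      nlinarith
    · refine Or.inr fun M hM hM2 => ⟨fun _ => M, fun _ => hM, fun k _ c _ => ?_, ?_⟩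
      · have : Nonempty (Fin M) := ⟨⟨0, hM⟩⟩
        have hinv : ∀ m, c (Function.invFun c (c m)) = c m := fun m =>
          Function.invFun_eq ⟨m, rfl⟩
        exact ⟨fun m => Function.invFun c (c m), fun m m' =>
          ⟨fun h => (hinv m).symm.trans ((congrArg c h).trans (hinv m')), fun h => by simp only [h]⟩⟩
      · have hMR : (0 : ℝ) < M := by exact_mod_cast hM
        have hMa : (M : ℝ) ≤ 2 * a ^ 2 := by
          refine hM2.trans ?_
          have : ((K + 2 : ℕ) : ℝ) * v / (√H / √n) ≤ a ^ 2 := by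
            rw [div_div_eq_mul_div, mul_assoc, ← ha_def, div_le_iff₀ (by linarith), pow_two]
            nlinarith [mul_pos ha0 ha0]
          linarith
        have hlogM : Real.log (2 * M) ≤ 4 * Real.log a := by
          have h4 : (4 : ℝ) ≤ Real.exp 1 ^ 2 := by nlinarith
          calc Real.log (2 * M) ≤ Real.log (a ^ 4) := by
                refine Real.log_le_log (by positivity) ?_
                nlinarith [pow_le_pow_left₀ (Real.exp_pos 1).le ha 2, sq_nonneg a]
            _ = _ := by rw [Real.log_pow]; norm_num
        rw [Finset.sum_const, Finset.card_range, nsmul_eq_mul]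
        have : (K : ℝ) * Real.log (2 * M) ≤ K * (4 * Real.log a) := by gcongr
        rw [hH]
        linarith
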